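/- arXiv:1801.10010 — 4 statements merged into one kernel-verified Lean document; each statement's English description precedes it below -/
import Mathlib

section
/- Let R and R' be domains with fraction fields K and K', with fixed absolute integral closures R⁺ and R'⁺, and let f : R → R' be a ring homomorphism. Assume either that f is injective, or that R is normal (integrally closed in K). If f⁺ and g⁺ are two ring homomorphisms R⁺ → R'⁺ both lifting f, then there exists an R-algebra automorphism σ of R⁺ such that g⁺ = f⁺ ∘ σ. -/
/-- A finite sequence `y` of elements of a commutative ring `B` is a regular sequence on `B`:
for each `i`, multiplication by `y i` is injective on `B/(y_1,…,y_{i-1})B`,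
and `B ≠ (y_1,…,y_m)B`. -/
def IsRegSeq {B : Type*} [CommRing B] {m : ℕ} (y : Fin m → B) : Prop :=
  (∀ i : Fin m, ∀ b : B,
      y i * b ∈ Ideal.span (y '' {j : Fin m | j < i}) →
        b ∈ Ideal.span (y '' {j : Fin m | j < i})) ∧
  Ideal.span (Set.range y) ≠ ⊤

/-- A `B`-algebra (given by a ring hom `φ : R →+* B`) is Cohen-Macaulay with respect to a
sequence `x` of elements of `R` if `x` becomes a regular sequence in `B`. -/
def IsCMwrt {R B : Type*} [CommRing R] [CommRing B] (φ : R →+* B)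
    {d : ℕ} (x : Fin d → R) : Prop :=
  IsRegSeq fun i => φ (x i)

/-- `x` is a system of parameters of the noetherian local ring `R`: `d` is the Krull dimension,
all `x i` lie in the maximal ideal, and they generate an ideal whose radical is the maximal
ideal. -/
def IsSOP (R : Type*) [CommRing R] [IsLocalRing R] {d : ℕ} (x : Fin d → R) : Prop :=
  (d : WithBot ℕ∞) = ringKrullDim R ∧
  (∀ i, x i ∈ IsLocalRing.maximalIdeal R) ∧
  (Ideal.span (Set.range x)).radical = IsLocalRing.maximalIdeal R

/-- `B` (via the structure map `φ`) is a big Cohen-Macaulay `R`-algebra: it is Cohen-Macaulay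
with respect to every system of parameters of `R`. -/
def IsBigCM {R B : Type*} [CommRing R] [IsLocalRing R] [CommRing B] (φ : R →+* B) : Prop :=
  ∀ (d : ℕ) (x : Fin d → R), IsSOP R x → IsCMwrt φ x

/-- `A` (as an `R`-algebra) is an absolute integral closure of the domain `R`:
it is a domain containing `R`, integral over `R`, and absolutely integrally closed
(every monic polynomial of positive degree has a root); equivalently, it is the
integral closure of `R` in an algebraic closure of its fraction field. -/
structure IsAbsIntClosure (R A : Type*) [CommRing R] [CommRing A] [Algebra R A] : Prop where
  isDomain : IsDomain A
  injective : Function.Injective (algebraMap R A)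
  isIntegral : Algebra.IsIntegral R A
  monic_root : ∀ P : Polynomial A, P.Monic → 0 < P.degree → ∃ a : A, P.IsRoot a

/-- `B` is `π^{1/p^∞}`-almost Cohen-Macaulay with respect to `x`, where `π : ℕ → B` is a
compatible system of `p`-th power roots. -/
def IsAlmostCMwrt {R B : Type*} [CommRing R] [CommRing B] (φ : R →+* B)
    (π : ℕ → B) {d : ℕ} (x : Fin d → R) : Prop :=
  (∀ i : Fin d, ∀ b : B,
      φ (x i) * b ∈ Ideal.span ((fun j => φ (x j)) '' {j : Fin d | j < i}) →
        ∀ e : ℕ, π e * b ∈ Ideal.span ((fun j => φ (x j)) '' {j : Fin d | j < i})) ∧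
  ¬ Ideal.span (Set.range π) ≤ Ideal.span (Set.range fun j => φ (x j))

open Polynomial in
/-- If every monic polynomial of positive degree over `A` has a root, then every monic polynomial
over `A` is a product of monic linear factors. -/
theorem exists_eq_prod_X_sub_C_of_monic {A : Type*} [CommRing A]
    (h : ∀ P : A[X], P.Monic → 0 < P.degree → ∃ a : A, P.IsRoot a) (P : A[X]) (hP : P.Monic) :
    ∃ s : Multiset A, P = (s.map fun a ↦ X - C a).prod := by
  nontriviality A
  induction hn : P.natDegree generalizing P with
  | zero => exact ⟨0, by simpa using hP.natDegree_eq_zero.mp hn⟩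
  | succ n ih =>
    obtain ⟨a, ha⟩ := h P hP (natDegree_pos_iff_degree_pos.mp (by lia))
    obtain ⟨Q, rfl⟩ := dvd_iff_isRoot.mpr ha
    have hQ : Q.Monic := (monic_X_sub_C a).of_mul_monic_left hP
    obtain ⟨s, rfl⟩ := ih Q hQ (by
      rw [(monic_X_sub_C a).natDegree_mul hQ, natDegree_X_sub_C] at hn
      lia)
    exact ⟨a ::ₘ s, by simp⟩

open Polynomial in
/-- If every monic polynomial of positive degree over `A` has a root, then any element of a domain
that is integral over `A` lies in the image of `A`. -/
theorem exists_eq_of_isIntegralElem {A L : Type*} [CommRing A] [CommRing L] [IsDomain L]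
    (h : ∀ P : A[X], P.Monic → 0 < P.degree → ∃ a : A, P.IsRoot a)
    (φ : A →+* L) {x : L} (hx : φ.IsIntegralElem x) : ∃ a, φ a = x := by
  obtain ⟨P, hP, hPx⟩ := hx
  obtain ⟨s, rfl⟩ := exists_eq_prod_X_sub_C_of_monic h P hP
  rw [← coe_eval₂RingHom, map_multiset_prod, Multiset.prod_eq_zero_iff] at hPx
  simp only [Multiset.map_map, Multiset.mem_map, Function.comp_apply, coe_eval₂RingHom,
    eval₂_sub, eval₂_X, eval₂_C] at hPx
  obtain ⟨a, -, ha⟩ := hPx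
  exact ⟨a, (sub_eq_zero.mp ha).symm⟩

open Polynomial in
/-- The fraction field of a domain over which every monic polynomial of positive degree has a
root is algebraically closed. -/
theorem isAlgClosed_fractionRing_of_monic_root (A : Type*) [CommRing A] [IsDomain A]
    (h : ∀ P : A[X], P.Monic → 0 < P.degree → ∃ a : A, P.IsRoot a) :
    IsAlgClosed (FractionRing A) := by
  let F := FractionRing A
  refine IsAlgClosed.of_exists_root _ fun p hp hirr ↦ ?_
  obtain ⟨x, hx⟩ := IsAlgClosed.exists_aeval_eq_zero (AlgebraicClosure F) p hirr.degree_pos.ne'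
  have hxalg : IsAlgebraic A x :=
    (IsFractionRing.isAlgebraic_iff A F (AlgebraicClosure F)).mpr ⟨p, hp.ne_zero, hx⟩
  obtain ⟨r, hr, hint⟩ := hxalg.exists_integral_multiple
  obtain ⟨a, ha⟩ := exists_eq_of_isIntegralElem h (algebraMap A (AlgebraicClosure F)) hint
  have hr' : algebraMap A F r ≠ 0 := by simpa using hr
  refine ⟨algebraMap A F a / algebraMap A F r, (algebraMap F (AlgebraicClosure F)).injective ?_⟩
  have hxe : x = algebraMap F (AlgebraicClosure F) (algebraMap A F a / algebraMap A F r) := by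
    rw [map_div₀, ← IsScalarTower.algebraMap_apply, ← IsScalarTower.algebraMap_apply,
      eq_div_iff, ha, Algebra.smul_def, mul_comm]
    rw [IsScalarTower.algebraMap_apply A F]
    simpa using hr
  rw [map_zero, ← hx, hxe, aeval_algebraMap_apply, coe_aeval_eq_eval]

/-- If `f` and `g` agree on a ring `R` over which the absolutely integrally closed ring `A` is
integral, then the image of `g` lies in that of `f`. -/
theorem exists_apply_eq_of_isIntegral {R A C : Type*} [CommRing R] [CommRing A] [CommRing C]
    [IsDomain C] [Algebra R A] [Algebra.IsIntegral R A]
    (h : ∀ P : Polynomial A, P.Monic → 0 < P.degree → ∃ a : A, P.IsRoot a) (f g : A →+* C)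
    (hfg : ∀ r : R, f (algebraMap R A r) = g (algebraMap R A r)) (a : A) :
    ∃ b, f b = g a := by
  refine exists_eq_of_isIntegralElem h f ?_
  obtain ⟨P, hP, hPa⟩ := Algebra.IsIntegral.isIntegral (R := R) a
  refine ⟨P.map (algebraMap R A), hP.map _, ?_⟩
  rw [Polynomial.eval₂_map, show f.comp (algebraMap R A) = g.comp (algebraMap R A) from
    RingHom.ext hfg, ← Polynomial.hom_eval₂, hPa, map_zero]

/-- The linear form in independent variables with coefficients `w`. -/
noncomputable def genericLinearForm {ι D : Type*} [Fintype ι] [CommSemiring D] (w : ι → D) :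
    MvPolynomial ι D :=
  ∑ i, MvPolynomial.C (w i) * MvPolynomial.X i

theorem map_genericLinearForm {ι D E : Type*} [Fintype ι] [CommSemiring D] [CommSemiring E]
    (φ : D →+* E) (w : ι → D) :
    MvPolynomial.map φ (genericLinearForm w) = genericLinearForm fun i ↦ φ (w i) := by
  simp [genericLinearForm]

theorem genericLinearForm_injective {ι D : Type*} [Fintype ι] [CommSemiring D] :
    Function.Injective (genericLinearForm : (ι → D) → MvPolynomial ι D) := by
  classical
  have key (w : ι → D) (i : ι) :
      MvPolynomial.coeff (Finsupp.single i 1) (genericLinearForm w) = w i := by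
    simp [genericLinearForm, MvPolynomial.coeff_sum, MvPolynomial.coeff_C_mul,
      MvPolynomial.coeff_X, Finsupp.single_left_inj]
  intro w w' h
  ext i
  rw [← key w, h, key]

/-- Two ring homomorphisms into a domain that agree on the invariants of a group acting with
finite orbits are conjugate on every finite set. -/
theorem exists_smul_eq_of_eq_on_invariants_finset {B C G : Type*} [CommRing B] [CommRing C]
    [IsDomain C] [Group G] [MulSemiringAction G B]
    (horb : ∀ b : B, (MulAction.orbit G b).Finite) (f g : B →+* C)
    (hfg : ∀ b : B, (∀ σ : G, σ • b = b) → f b = g b) (s : Finset B) :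
    ∃ σ : G, ∀ b ∈ s, g b = f (σ • b) := by
  classical
  have hfin : (Set.range fun (σ : G) (b : s) ↦ σ • (b : B)).Finite := by
    refine (Set.Finite.pi' fun b : s ↦ horb b).subset ?_
    rintro _ ⟨σ, rfl⟩ b
    exact ⟨σ, rfl⟩
  let W := hfin.toFinset
  have hW (w : s → B) : w ∈ W ↔ ∃ σ : G, (fun b : s ↦ σ • (b : B)) = w := by simp [W]
  let F : Polynomial (MvPolynomial s B) :=
    ∏ w ∈ W, (Polynomial.X - Polynomial.C (genericLinearForm w))
  have hmap (φ : B →+* C) : F.map (MvPolynomial.map φ) =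
      ∏ w ∈ W, (Polynomial.X - Polynomial.C (genericLinearForm fun b ↦ φ (w b))) := by
    simp [F, Polynomial.map_prod, map_genericLinearForm]
  have hinv (σ : G) : F.map (MvPolynomial.map (MulSemiringAction.toRingHom G B σ)) = F := by
    simp only [F, Polynomial.map_prod, Polynomial.map_sub, Polynomial.map_X, Polynomial.map_C,
      map_genericLinearForm]
    refine Finset.prod_equiv (MulAction.toPerm σ) (fun w ↦ ?_) fun w _ ↦ rfl
    simp only [hW, MulAction.toPerm_apply]
    constructor
    · rintro ⟨τ, rfl⟩
      exact ⟨σ * τ, funext fun b ↦ mul_smul σ τ (b : B)⟩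
    · rintro ⟨τ, hτ⟩
      refine ⟨σ⁻¹ * τ, funext fun b ↦ ?_⟩
      rw [mul_smul, inv_smul_eq_iff]
      exact congrFun hτ b
  have hcoeff : F.map (MvPolynomial.map f) = F.map (MvPolynomial.map g) := by
    ext n m
    simp only [Polynomial.coeff_map, MvPolynomial.coeff_map]
    refine hfg _ fun σ ↦ ?_
    conv_rhs => rw [← hinv σ]
    simp only [Polynomial.coeff_map, MvPolynomial.coeff_map, MulSemiringAction.toRingHom_apply]
  have hroot :
      (F.map (MvPolynomial.map g)).eval (genericLinearForm fun b : s ↦ g (b : B)) = 0 := by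
    rw [hmap, Polynomial.eval_prod]
    refine Finset.prod_eq_zero ((hW fun b : s ↦ (b : B)).mpr ⟨1, by simp⟩) (by simp)
  rw [← hcoeff, hmap, Polynomial.eval_prod, Finset.prod_eq_zero_iff] at hroot
  obtain ⟨w, hw, hw0⟩ := hroot
  obtain ⟨σ, rfl⟩ := (hW w).mp hw
  rw [Polynomial.eval_sub, Polynomial.eval_X, Polynomial.eval_C, sub_eq_zero] at hw0
  exact ⟨σ, fun b hb ↦ congrFun (genericLinearForm_injective hw0) ⟨b, hb⟩⟩

/-- Two ring homomorphisms into a domain that agree on the invariants of a compact group acting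
with open stabilizers are conjugate. -/
theorem exists_smul_eq_of_eq_on_invariants {B C G : Type*} [CommRing B] [CommRing C]
    [IsDomain C] [Group G] [MulSemiringAction G B] [TopologicalSpace G] [IsTopologicalGroup G]
    [CompactSpace G] (hopen : ∀ b : B, IsOpen (MulAction.stabilizer G b : Set G))
    (f g : B →+* C) (hfg : ∀ b : B, (∀ σ : G, σ • b = b) → f b = g b) :
    ∃ σ : G, ∀ b, g b = f (σ • b) := by
  let : TopologicalSpace B := ⊥
  have : DiscreteTopology B := ⟨rfl⟩
  have : ContinuousSMul G B := continuousSMul_iff_stabilizer_isOpen.mpr hopen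
  have hcont (b : B) : Continuous fun σ : G ↦ σ • b := by fun_prop
  have horb (b : B) : (MulAction.orbit G b).Finite := (isCompact_range (hcont b)).finite_of_discrete
  have hclosed (b : B) : IsClosed {σ : G | g b = f (σ • b)} :=
    (isClosed_discrete {x : B | g b = f x}).preimage (hcont b)
  obtain ⟨σ, hσ⟩ := CompactSpace.iInter_nonempty hclosed fun s ↦ by
    obtain ⟨σ, hσ⟩ := exists_smul_eq_of_eq_on_invariants_finset horb f g hfg s
    exact ⟨σ, by simpa using hσ⟩
  exact ⟨σ, by simpa using hσ⟩

/-- Over a normal domain, an element of an algebraic closure which is integral and purely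
inseparable has the same image under ring homomorphisms agreeing on the base. -/
theorem apply_eq_of_mem_perfectClosure {R A C : Type*} [CommRing R] [IsDomain R]
    [IsIntegrallyClosed R] [CommRing A] [IsDomain A] [CommRing C] [IsDomain C] [Algebra R A]
    [Algebra.IsIntegral R A] [FaithfulSMul R A]
    [Algebra (FractionRing R) (FractionRing A)]
    [IsScalarTower R (FractionRing R) (FractionRing A)] (f g : A →+* C)
    (hfg : ∀ r : R, f (algebraMap R A r) = g (algebraMap R A r)) (a : A)
    (ha : algebraMap A (FractionRing A) a ∈
      perfectClosure (FractionRing R) (FractionRing A)) : f a = g a := by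
  let K := FractionRing R
  let L := FractionRing A
  obtain ⟨q, hq⟩ := ExpChar.exists K
  obtain ⟨n, y, hy⟩ := (mem_perfectClosure_iff_pow_mem q).mp ha
  have hint : IsIntegral R (a ^ q ^ n) := Algebra.IsIntegral.isIntegral _
  have hyint : IsIntegral R y := by
    rw [← isIntegral_algebraMap_iff (algebraMap K L).injective, hy, ← map_pow]
    exact hint.algebraMap
  obtain ⟨r, rfl⟩ := IsIntegrallyClosed.isIntegral_iff.mp hyint
  have hr : algebraMap R A r = a ^ q ^ n := by
    apply IsFractionRing.injective A L
    rw [map_pow, ← hy, ← IsScalarTower.algebraMap_apply, ← IsScalarTower.algebraMap_apply]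
  have hpow : f a ^ q ^ n = g a ^ q ^ n := by
    rw [← map_pow, ← map_pow, ← hr, hfg]
  cases hq with
  | zero => simpa using hpow
  | prime hq =>
    have hR : (q : R) = 0 := by
      apply IsFractionRing.injective R K
      rw [map_natCast, map_zero, CharP.cast_eq_zero]
    have : CharP C q := (CharP.charP_iff_prime_eq_zero hq).mpr (by
      simpa using congrArg (fun r ↦ f (algebraMap R A r)) hR)
    have : ExpChar C q := .prime hq
    exact iterateFrobenius_inj C q n hpow

/-- Two injective ring homomorphisms with the same range differ by an automorphism of the source. -/
theorem exists_ringEquiv_of_range_eq {A C : Type*} [CommRing A] [CommRing C] {f g : A →+* C}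
    (hf : Function.Injective f) (hg : Function.Injective g) (h : f.range = g.range) :
    ∃ σ : A ≃+* A, ∀ a, g a = f (σ a) := by
  let ef : A ≃+* f.range := RingEquiv.ofBijective f.rangeRestrict
    ⟨fun _ _ hab ↦ hf (congrArg Subtype.val hab), f.rangeRestrict_surjective⟩
  let eg : A ≃+* g.range := RingEquiv.ofBijective g.rangeRestrict
    ⟨fun _ _ hab ↦ hg (congrArg Subtype.val hab), g.rangeRestrict_surjective⟩
  let c := RingEquiv.subringCongr h.symm
  exact ⟨(eg.trans c).trans ef.symm, fun a ↦
    (congrArg Subtype.val (ef.apply_symm_apply (c (eg a)))).symm⟩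

/-- A ring homomorphism from an integral extension which is a domain is injective if it is so on
the base. -/
theorem injective_of_comp_algebraMap_injective {R A C : Type*} [CommRing R] [Nontrivial R]
    [CommRing A] [IsDomain A] [CommRing C] [Algebra R A] [Algebra.IsIntegral R A] (φ : A →+* C)
    (hφ : Function.Injective (φ.comp (algebraMap R A))) : Function.Injective φ := by
  rw [RingHom.injective_iff_ker_eq_bot] at hφ ⊢
  refine Ideal.eq_bot_of_comap_eq_bot (R := R) ?_
  rwa [RingHom.comap_ker]

/-- Two ring homomorphisms from an absolutely integrally closed integral extension of a normal
domain `R` to a domain that agree on `R` differ by an `R`-algebra automorphism. -/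
theorem exists_algEquiv_of_isIntegrallyClosed {R A C : Type*} [CommRing R] [IsDomain R]
    [IsIntegrallyClosed R] [CommRing A] [IsDomain A] [CommRing C] [IsDomain C] [Algebra R A]
    [Algebra.IsIntegral R A] [FaithfulSMul R A]
    (h : ∀ P : Polynomial A, P.Monic → 0 < P.degree → ∃ a : A, P.IsRoot a) (f g : A →+* C)
    (hfg : ∀ r : R, f (algebraMap R A r) = g (algebraMap R A r)) :
    ∃ σ : A ≃ₐ[R] A, ∀ a, g a = f (σ a) := by
  let K := FractionRing R
  let L := FractionRing A
  have : IsAlgClosed L := isAlgClosed_fractionRing_of_monic_root A h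
  let : Algebra K L := FractionRing.liftAlgebra R L
  have : IsScalarTower R K L := inferInstance
  have : Algebra.IsAlgebraic K L :=
    have : Algebra.IsAlgebraic A L := IsLocalization.isAlgebraic L (nonZeroDivisors A)
    have : Algebra.IsAlgebraic R L := Algebra.IsAlgebraic.trans R A L
    (IsFractionRing.comap_isAlgebraic_iff (A := R) (K := K) (C := L)).mp this
  let P := perfectClosure K L
  have : Algebra.IsAlgebraic P L := Algebra.IsAlgebraic.tower_top (K := K) P
  have : Normal P L := normal_iff.mpr fun x ↦
    ⟨Algebra.IsIntegral.isIntegral x, IsAlgClosed.splits _⟩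
  have : IsGalois P L := ⟨⟩
  let G := L ≃ₐ[P] L
  have : SMulCommClass G R L := ⟨fun σ r x ↦ by
    rw [← algebraMap_smul K r, ← algebraMap_smul K r]
    exact map_smul (σ.restrictScalars K) _ x⟩
  have : IsIntegralClosure A R L :=
    { algebraMap_injective := IsFractionRing.injective A L
      isIntegral_iff := fun {x} ↦ ⟨fun hx ↦
          exists_eq_of_isIntegralElem h (algebraMap A L) (hx.tower_top (A := A)),
        by rintro ⟨a, rfl⟩; exact (Algebra.IsIntegral.isIntegral a).algebraMap⟩ }
  let e : integralClosure R L ≃ₐ[R] A := IsIntegralClosure.equiv R _ L A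
  have he (b : integralClosure R L) : algebraMap A L (e b) = b :=
    IsIntegralClosure.algebraMap_equiv R _ L A b
  obtain ⟨σ, hσ⟩ := exists_smul_eq_of_eq_on_invariants (G := G) (B := integralClosure R L)
    (fun b ↦ by
      convert stabilizer_isOpen_of_isIntegral (K := P) (b : L) using 1
      ext σ
      exact Subtype.ext_iff)
    (f.comp e.toRingEquiv.toRingHom) (g.comp e.toRingEquiv.toRingHom) (fun b hb ↦ by
      refine apply_eq_of_mem_perfectClosure f g hfg _ ?_
      obtain ⟨x, hx⟩ := (InfiniteGalois.mem_range_algebraMap_iff_fixed (k := P) (b : L)).mpr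
        fun σ ↦ congrArg Subtype.val (hb σ)
      have : algebraMap A L (e b) ∈ P := by
        rw [he, ← hx]
        exact x.2
      exact this)
  refine ⟨(e.symm.trans (MulSemiringAction.toAlgEquiv R _ σ)).trans e, fun a ↦ ?_⟩
  simpa using hσ (e.symm a)

/-- **Proposition 2.1 (2)**: if `f : R → R'` is injective, or `R` is normal, then any two
liftings `f⁺, g⁺ : R⁺ → R'⁺` of `f` to absolute integral closures differ by precomposition
with an `R`-algebra automorphism of `R⁺`. -/
theorem abs_int_closure_lift_unique
    (R R' : Type) [CommRing R] [CommRing R'] [IsDomain R] [IsDomain R']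
    (Rplus R'plus : Type) [CommRing Rplus] [CommRing R'plus]
    [Algebra R Rplus] [Algebra R' R'plus]
    (hRplus : IsAbsIntClosure R Rplus) (hR'plus : IsAbsIntClosure R' R'plus)
    (f : R →+* R')
    (hyp : Function.Injective f ∨ IsIntegrallyClosed R)
    (fplus gplus : Rplus →+* R'plus)
    (hfplus : ∀ r : R, fplus (algebraMap R Rplus r) = algebraMap R' R'plus (f r))
    (hgplus : ∀ r : R, gplus (algebraMap R Rplus r) = algebraMap R' R'plus (f r)) :
    ∃ σ : Rplus ≃+* Rplus,
      (∀ r : R, σ (algebraMap R Rplus r) = algebraMap R Rplus r) ∧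
      ∀ a : Rplus, gplus a = fplus (σ a) := by
  have := hRplus.isDomain
  have := hR'plus.isDomain
  have := hRplus.isIntegral
  have : FaithfulSMul R Rplus :=
    (faithfulSMul_iff_algebraMap_injective R Rplus).mpr hRplus.injective
  have hfg (r : R) : fplus (algebraMap R Rplus r) = gplus (algebraMap R Rplus r) := by
    rw [hfplus, hgplus]
  rcases hyp with hf | hR
  · have hinj (φ : Rplus →+* R'plus)
        (hφ : ∀ r : R, φ (algebraMap R Rplus r) = algebraMap R' R'plus (f r)) :
        Function.Injective φ :=
      injective_of_comp_algebraMap_injective φ (by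
        rw [show φ.comp (algebraMap R Rplus) = (algebraMap R' R'plus).comp f from RingHom.ext hφ]
        exact hR'plus.injective.comp hf)
    have hfinj := hinj fplus hfplus
    have hrange : fplus.range = gplus.range := by
      apply le_antisymm <;> rintro _ ⟨a, rfl⟩
      · exact exists_apply_eq_of_isIntegral hRplus.monic_root gplus fplus (fun r ↦ (hfg r).symm) a
      · exact exists_apply_eq_of_isIntegral hRplus.monic_root fplus gplus hfg a
    obtain ⟨σ, hσ⟩ := exists_ringEquiv_of_range_eq hfinj (hinj gplus hgplus) hrange
    exact ⟨σ, fun r ↦ hfinj (by rw [← hσ, hfg]), hσ⟩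
  · obtain ⟨σ, hσ⟩ := exists_algEquiv_of_isIntegrallyClosed hRplus.monic_root fplus gplus hfg
    exact ⟨σ.toRingEquiv, σ.commutes, hσ⟩
end

section
/- Let R be a normal domain (integrally closed in its fraction field) and let R_1, …, R_{n-1}, R' be domains, each equipped with a fixed absolute integral closure R⁺, R_1⁺, …, R_{n-1}⁺, R'⁺. Suppose a ring homomorphism f : R → R' factors as f = f_n ∘ ⋯ ∘ f_1 with f_1 : R → R_1, f_i : R_{i-1} → R_i, f_n : R_{n-1} → R'. Then for any given lifting f⁺ : R⁺ → R'⁺ of f, there exist liftings f_i⁺ : R_{i-1}⁺ → R_i⁺ of each f_i such that f⁺ = f_n⁺ ∘ ⋯ ∘ f_1⁺. -/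
/-- The composite `A 0 →+* A i` of a chain of ring homomorphisms `f j : A j → A (j+1)`. -/
def chainComp {n : ℕ} {A : Fin (n + 1) → Type} [∀ i, CommRing (A i)]
    (f : ∀ i : Fin n, A i.castSucc →+* A i.succ) (i : Fin (n + 1)) : A 0 →+* A i :=
  Fin.induction (RingHom.id (A 0)) (fun j g => (f j).comp g) i

section

open Polynomial

theorem isIntegrallyClosed_of_exists_isRoot {B : Type*} [CommRing B] [IsDomain B]
    (h : ∀ P : B[X], P.Monic → 0 < P.degree → ∃ a : B, P.IsRoot a) : IsIntegrallyClosed B := by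
  rw [isIntegrallyClosed_iff (FractionRing B)]
  intro x hx
  obtain ⟨a, ha⟩ := h _ (minpoly.monic hx) (minpoly.degree_pos hx)
  obtain ⟨q, hq⟩ := dvd_iff_isRoot.mpr ha
  have hq_monic : q.Monic := (monic_X_sub_C a).of_mul_monic_left (hq ▸ minpoly.monic hx)
  have hmul : (x - algebraMap B _ a) * aeval x q = 0 := by
    simpa [hq] using minpoly.aeval B x
  refine ⟨a, (sub_eq_zero.mp ((mul_eq_zero.mp hmul).resolve_right fun hqx => ?_)).symm⟩
  have hle := minpoly.min B x hq_monic hqx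
  rw [hq, degree_mul, degree_X_sub_C, degree_eq_natDegree hq_monic.ne_zero] at hle
  norm_cast at hle
  omega

theorem isAlgClosed_of_exists_isRoot {B : Type*} [CommRing B] [IsDomain B]
    (h : ∀ P : B[X], P.Monic → 0 < P.degree → ∃ a : B, P.IsRoot a)
    (L : Type*) [Field L] [Algebra B L] [IsFractionRing B L] : IsAlgClosed L := by
  refine IsAlgClosed.of_exists_root L fun p hp hirr => ?_
  let d := IsLocalization.commonDenom (nonZeroDivisors B) p.support p.coeff
  have hd : algebraMap B L d ≠ 0 := IsFractionRing.to_map_ne_zero_of_mem_nonZeroDivisors d.2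
  obtain ⟨q, hq, hdeg, hq_monic⟩ := lifts_and_natDegree_eq_and_monic
    (IsLocalization.scaleRoots_commonDenom_mem_lifts (nonZeroDivisors B) p
      ⟨1, by rw [hp.leadingCoeff, map_one]⟩) ((monic_scaleRoots_iff _).mpr hp)
  obtain ⟨a, ha⟩ := h q hq_monic <| natDegree_pos_iff_degree_pos.mp <| by
    rw [hdeg, natDegree_scaleRoots]
    exact hirr.natDegree_pos
  refine ⟨algebraMap B L a / algebraMap B L d, ?_⟩
  have key := scaleRoots_eval₂_mul (p := p) (RingHom.id L)
    (algebraMap B L a / algebraMap B L d) (algebraMap B L d)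
  rw [RingHom.id_apply, mul_div_cancel₀ _ hd, ← hq, ← eval, eval_map_apply, ha.eq_zero, map_zero]
    at key
  exact (mul_eq_zero.mp key.symm).resolve_left (pow_ne_zero _ hd)

/-- A homomorphism to an absolutely integrally closed domain extends along any injective integral
homomorphism. -/
theorem exists_ringHom_extension_of_isIntegral {A B C : Type*} [CommRing A] [CommRing B]
    [IsDomain B] [CommRing C] [IsDomain C] [Algebra A B] [Algebra.IsIntegral A B]
    (hinj : Function.Injective (algebraMap A B))
    (hC : ∀ P : C[X], P.Monic → 0 < P.degree → ∃ a : C, P.IsRoot a) (φ : A →+* C) :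
    ∃ ψ : B →+* C, ψ.comp (algebraMap A B) = φ := by
  have : IsIntegrallyClosed C := isIntegrallyClosed_of_exists_isRoot hC
  let M := FractionRing C
  have : IsAlgClosed M := isAlgClosed_of_exists_isRoot hC M
  have : (RingHom.ker φ).IsPrime := RingHom.ker_isPrime φ
  obtain ⟨Q, hQ, hQP⟩ := Ideal.exists_ideal_over_prime_of_isIntegral_of_isDomain (S := B)
    (RingHom.ker φ) (by rw [(RingHom.injective_iff_ker_eq_bot _).mp hinj]; exact bot_le)
  have : Q.LiesOver (RingHom.ker φ) := ⟨hQP.symm⟩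
  let : Algebra (A ⧸ RingHom.ker φ) M := ((algebraMap C M).comp φ.kerLift).toAlgebra
  have : FaithfulSMul (A ⧸ RingHom.ker φ) M := (faithfulSMul_iff_algebraMap_injective _ _).mpr
    ((IsFractionRing.injective C M).comp φ.kerLift_injective)
  have : Module.IsTorsionFree (A ⧸ RingHom.ker φ) (B ⧸ Q) := .trans_faithfulSMul _ (B ⧸ Q) _
  have : Module.IsTorsionFree (A ⧸ RingHom.ker φ) M := .trans_faithfulSMul _ M _
  let θ : (B ⧸ Q) →ₐ[A ⧸ RingHom.ker φ] M := IsAlgClosed.lift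
  let ρ : B →+* M := (θ : B ⧸ Q →+* M).comp (Ideal.Quotient.mk Q)
  have hρ : (algebraMap C M).comp φ = ρ.comp (algebraMap A B) := by
    ext a
    exact (θ.commutes (Ideal.Quotient.mk _ a)).symm
  have hmem (b : B) : ρ b ∈ (algebraMap C M).range :=
    IsIntegrallyClosed.isIntegral_iff.mp
      ((Algebra.IsIntegral.isIntegral (R := A) b).map_of_comp_eq φ ρ hρ)
  choose ψ hψ using hmem
  have hM := IsFractionRing.injective C M
  refine ⟨⟨⟨⟨ψ, hM ?_⟩, fun x y => hM ?_⟩, hM ?_, fun x y => hM ?_⟩, RingHom.ext fun a => hM ?_⟩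
  · simp [hψ]
  · simp [hψ]
  · simp [hψ]
  · simp [hψ]
  · exact (hψ _).trans (congr($hρ a)).symm

section Action

variable {G B C : Type*} [Group G] [CommRing B] [MulSemiringAction G B] [CommRing C] {φ ψ : B →+* C}

theorem Polynomial.finite_orbit_of_finite_orbits (hfin : ∀ b : B, (MulAction.orbit G b).Finite)
    (u : B[X]) : (MulAction.orbit G u).Finite := by
  refine Set.Finite.of_finite_image (f := fun v i => coeff v (i : Fin (u.natDegree + 1)))
    ((Set.Finite.pi fun i : Fin (u.natDegree + 1) => hfin (u.coeff i)).subset ?_) ?_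
  · rintro _ ⟨_, ⟨g, rfl⟩, rfl⟩ i -
    exact ⟨g, by simp⟩
  · rintro _ ⟨g, rfl⟩ _ ⟨g', rfl⟩ h
    ext i
    by_cases hi : i < u.natDegree + 1
    · exact congr_fun h ⟨i, hi⟩
    · simp [coeff_eq_zero_of_natDegree_lt (p := u) (n := i) (by omega)]

theorem Polynomial.exists_map_eq_map_smul [IsDomain C]
    (h : ∀ b : B, (∀ g : G, g • b = b) → φ b = ψ b)
    (hfin : ∀ b : B, (MulAction.orbit G b).Finite) (u : B[X]) :
    ∃ g : G, u.map ψ = (g • u).map φ := by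
  let s := (finite_orbit_of_finite_orbits hfin u).toFinset
  let P : B[X][X] := ∏ v ∈ s, (X - Polynomial.C v)
  have hP (g : G) : g • P = P := by
    simp only [P, Finset.smul_prod', smul_sub, smul_X, Polynomial.smul_C]
    refine Finset.prod_bij (fun v _ => g • v) ?_ ?_ ?_ ?_
    · exact fun v hv => by
        simpa [s] using MulAction.mem_orbit_of_mem_orbit g (by simpa [s] using hv)
    · simp
    · intro v hv
      exact ⟨g⁻¹ • v,
        by simpa [s] using MulAction.mem_orbit_of_mem_orbit g⁻¹ (by simpa [s] using hv), by simp⟩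
    · simp
  have hmap : P.map (mapRingHom ψ) = P.map (mapRingHom φ) := by
    ext i j
    simp only [coeff_map, coe_mapRingHom]
    refine (h _ fun g => ?_).symm
    rw [← coeff_smul, ← coeff_smul, hP]
  have hroot : (P.map (mapRingHom ψ)).eval (u.map ψ) = 0 := by
    simp only [P, Polynomial.map_prod, eval_prod]
    exact Finset.prod_eq_zero (i := u) (by simp [s]) (by simp)
  rw [hmap] at hroot
  simp only [P, Polynomial.map_prod, eval_prod, Finset.prod_eq_zero_iff] at hroot
  obtain ⟨v, hv, hv'⟩ := hroot
  obtain ⟨g, rfl⟩ : v ∈ MulAction.orbit G u := by simpa [s] using hv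
  exact ⟨g, by simpa [sub_eq_zero] using hv'⟩

/-- Two homomorphisms to a domain which agree on the invariants of a compact group differ by an
element of the group. -/
theorem exists_forall_eq_map_smul [IsDomain C] [TopologicalSpace G] [CompactSpace G]
    [TopologicalSpace B] [DiscreteTopology B] [ContinuousSMul G B]
    (h : ∀ b : B, (∀ g : G, g • b = b) → φ b = ψ b) :
    ∃ g : G, ∀ b : B, ψ b = φ (g • b) := by
  classical
  have hcont (b : B) : Continuous fun g : G => g • b := by fun_prop
  have hfin (b : B) : (MulAction.orbit G b).Finite := (isCompact_range (hcont b)).finite_of_discrete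
  obtain ⟨g, hg⟩ := CompactSpace.iInter_nonempty (t := fun b : B => {g : G | ψ b = φ (g • b)})
    (fun b => (isClosed_discrete {c : B | ψ b = φ c}).preimage (hcont b)) fun s => by
      obtain ⟨g, hg⟩ := exists_map_eq_map_smul h hfin (ofFn s.card fun i => (s.equivFin.symm i : B))
      refine ⟨g, Set.mem_iInter₂.mpr fun b hb => ?_⟩
      simpa [ofFn_coeff_eq_val_of_lt] using congr(coeff $hg (s.equivFin ⟨b, hb⟩))
  exact ⟨g, fun b => Set.mem_iInter.mp hg b⟩

end Action

/-- Two liftings of the same homomorphism from a normal domain differ by an automorphism of its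
absolute integral closure. -/
theorem IsAbsIntClosure.exists_algEquiv_comp_eq {A B C : Type*} [CommRing A] [IsDomain A]
    [IsIntegrallyClosed A] [CommRing B] [CommRing C] [IsDomain C] [Algebra A B]
    (hB : IsAbsIntClosure A B) {φ ψ : B →+* C}
    (h : φ.comp (algebraMap A B) = ψ.comp (algebraMap A B)) :
    ∃ σ : B ≃ₐ[A] B, φ.comp (σ : B →+* B) = ψ := by
  have := hB.isDomain
  have := hB.isIntegral
  have : FaithfulSMul A B := (faithfulSMul_iff_algebraMap_injective _ _).mpr hB.injective
  let K := FractionRing A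
  let L := FractionRing B
  let : Algebra K L := FractionRing.liftAlgebra A L
  have : IsScalarTower A K L := FractionRing.isScalarTower_liftAlgebra A L
  have : IsIntegrallyClosed B := isIntegrallyClosed_of_exists_isRoot hB.monic_root
  have : IsIntegralClosure B A L := .of_isIntegrallyClosed B A L
  have : IsAlgClosed L := isAlgClosed_of_exists_isRoot hB.monic_root L
  have : Algebra.IsAlgebraic A L := (IsFractionRing.isAlgebraic_iff' A B L).1 inferInstance
  have : Algebra.IsAlgebraic K L :=
    ⟨fun x => (IsFractionRing.isAlgebraic_iff A K L).1 (Algebra.IsAlgebraic.isAlgebraic x)⟩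
  let E := perfectClosure K L
  have : IsAlgClosure E L := ⟨inferInstance, inferInstance⟩
  have : Normal E L := IsAlgClosure.normal _ _
  have : IsGalois E L := ⟨⟩
  let ρ : Gal(L/E) →* (B ≃ₐ[A] B) :=
    (galRestrict A K L B).toMonoidHom.comp (AlgEquiv.restrictScalarsHom K)
  have hρ (g : Gal(L/E)) (b : B) : algebraMap B L (ρ g b) = g (algebraMap B L b) :=
    algebraMap_galRestrict_apply A _ b
  let : MulSemiringAction Gal(L/E) B := MulSemiringAction.compHom B ρ
  have hsmul (g : Gal(L/E)) (b : B) : g • b = ρ g b := rfl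
  let : TopologicalSpace B := ⊥
  have : DiscreteTopology B := ⟨rfl⟩
  have hBL := IsFractionRing.injective B L
  have : ContinuousSMul Gal(L/E) B := by
    refine continuousSMul_iff_stabilizer_isOpen.mpr fun b => ?_
    convert stabilizer_isOpen_of_isIntegral (K := E) (algebraMap B L b) using 2
    ext g
    rw [MulAction.mem_stabilizer_iff, MulAction.mem_stabilizer_iff, AlgEquiv.smul_def, ← hρ,
      hBL.eq_iff, hsmul]
  obtain ⟨g, hg⟩ := exists_forall_eq_map_smul (G := Gal(L/E)) (φ := φ) (ψ := ψ) fun b hb => by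
    have hbE : algebraMap B L b ∈ (⊥ : IntermediateField E L) :=
      (InfiniteGalois.mem_bot_iff_fixed _).mpr fun g => by rw [← hρ, ← hsmul, hb]
    obtain ⟨e, he⟩ := IntermediateField.mem_bot.mp hbE
    obtain ⟨q, hq⟩ := ExpChar.exists K
    obtain ⟨n, k, hk⟩ := (mem_perfectClosure_iff_pow_mem q).mp e.2
    have hkb : algebraMap K L k = algebraMap B L (b ^ q ^ n) := by
      rw [hk, map_pow, ← he]
      rfl
    have hint : IsIntegral A k := by
      rw [← isIntegral_algebraMap_iff (algebraMap K L).injective, hkb]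
      exact (Algebra.IsIntegral.isIntegral (R := A) (b ^ q ^ n)).algebraMap
    obtain ⟨a, rfl⟩ := IsIntegrallyClosed.isIntegral_iff.mp hint
    have hab : algebraMap A B a = b ^ q ^ n := hBL <| by
      rw [← hkb, ← IsScalarTower.algebraMap_apply, ← IsScalarTower.algebraMap_apply]
    have hpow : φ b ^ q ^ n = ψ b ^ q ^ n := by
      rw [← map_pow, ← map_pow, ← hab]
      exact congr($h a)
    cases hq with
    | zero => simpa using hpow
    | prime hq =>
      have hA : (q : A) = 0 := IsFractionRing.injective A K <| by
        rw [map_natCast, map_zero, CharP.cast_eq_zero K q]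
      have hC : (q : C) = 0 := by simpa using congr(φ (algebraMap A B $hA))
      have : CharP C q := ringChar.of_eq <|
        (hq.eq_one_or_self_of_dvd _ (ringChar.dvd hC)).resolve_left CharP.ringChar_ne_one
      have : ExpChar C q := .prime hq
      exact iterateFrobenius_inj C q n hpow
  exact ⟨ρ g, RingHom.ext fun b => (hg b).symm⟩

end

theorem chainComp_succ {n : ℕ} {A : Fin (n + 1) → Type} [∀ i, CommRing (A i)]
    (f : ∀ i : Fin n, A i.castSucc →+* A i.succ) (i : Fin n) :
    chainComp f i.succ = (f i).comp (chainComp f i.castSucc) := by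
  simp only [chainComp, Fin.induction_succ]

theorem chainComp_update_zero_comp {n : ℕ} {A : Fin (n + 2) → Type} [∀ i, CommRing (A i)]
    (f : ∀ i : Fin (n + 1), A i.castSucc →+* A i.succ) (σ : A 0 →+* A 0) (i : Fin (n + 1)) :
    chainComp (Function.update f 0 (RingHom.comp (f 0) σ)) i.succ =
      (chainComp f i.succ).comp σ := by
  induction i using Fin.induction with
  | zero => rw [chainComp_succ, chainComp_succ, Function.update_self]; rfl
  | succ i ih =>
    rw [chainComp_succ, chainComp_succ, Function.update_of_ne (Fin.succ_ne_zero i),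
      RingHom.comp_assoc]
    exact congrArg (f i.succ).comp ih

theorem chainComp_algebraMap {n : ℕ} {A B : Fin (n + 1) → Type} [∀ i, CommRing (A i)]
    [∀ i, CommRing (B i)] [∀ i, Algebra (A i) (B i)]
    (f : ∀ i : Fin n, A i.castSucc →+* A i.succ) (g : ∀ i : Fin n, B i.castSucc →+* B i.succ)
    (h : ∀ (i : Fin n) (r : A i.castSucc),
      g i (algebraMap (A i.castSucc) (B i.castSucc) r) = algebraMap (A i.succ) (B i.succ) (f i r))
    (i : Fin (n + 1)) (r : A 0) :
    chainComp g i (algebraMap (A 0) (B 0) r) = algebraMap (A i) (B i) (chainComp f i r) := by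
  induction i using Fin.induction with
  | zero => rfl
  | succ i ih =>
    rw [chainComp_succ, chainComp_succ, RingHom.comp_apply, RingHom.comp_apply, ih, h]

/-- **Proposition 2.1 (3)**: for `R` normal, any factorization
`R → R_1 → ⋯ → R_{n-1} → R'` of `f` through domains lifts to a factorization of any given
lifting `f⁺ : R⁺ → R'⁺` through the absolute integral closures. -/
theorem abs_int_closure_lift_factorization
    (n : ℕ) (hn : 0 < n)
    (A : Fin (n + 1) → Type) [∀ i, CommRing (A i)] [∀ i, IsDomain (A i)]
    [IsIntegrallyClosed (A 0)]
    (Aplus : Fin (n + 1) → Type) [∀ i, CommRing (Aplus i)] [∀ i, Algebra (A i) (Aplus i)]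
    (hAplus : ∀ i, IsAbsIntClosure (A i) (Aplus i))
    (f : ∀ i : Fin n, A i.castSucc →+* A i.succ)
    (fplus : Aplus 0 →+* Aplus (Fin.last n))
    (hfplus : ∀ r : A 0,
      fplus (algebraMap (A 0) (Aplus 0) r) =
        algebraMap (A (Fin.last n)) (Aplus (Fin.last n)) (chainComp f (Fin.last n) r)) :
    ∃ g : ∀ i : Fin n, Aplus i.castSucc →+* Aplus i.succ,
      (∀ (i : Fin n) (r : A i.castSucc),
        g i (algebraMap (A i.castSucc) (Aplus i.castSucc) r) =
          algebraMap (A i.succ) (Aplus i.succ) (f i r)) ∧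
      chainComp g (Fin.last n) = fplus := by
  obtain ⟨m, rfl⟩ := Nat.exists_eq_succ_of_ne_zero hn.ne'
  have hdom (i) : IsDomain (Aplus i) := (hAplus i).isDomain
  have hlift (i : Fin (m + 1)) : ∃ g : Aplus i.castSucc →+* Aplus i.succ,
      g.comp (algebraMap (A i.castSucc) (Aplus i.castSucc)) =
        (algebraMap (A i.succ) (Aplus i.succ)).comp (f i) :=
    have := (hAplus i.castSucc).isIntegral
    exists_ringHom_extension_of_isIntegral (hAplus i.castSucc).injective
      (hAplus i.succ).monic_root _
  choose g hg using hlift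
  have hg' (i : Fin (m + 1)) (r : A i.castSucc) :
      g i (algebraMap (A i.castSucc) (Aplus i.castSucc) r) =
        algebraMap (A i.succ) (Aplus i.succ) (f i r) := congr($(hg i) r)
  obtain ⟨σ, hσ⟩ := (hAplus 0).exists_algEquiv_comp_eq (φ := chainComp g (Fin.last (m + 1)))
    (ψ := fplus) <| RingHom.ext fun r =>
      (chainComp_algebraMap f g hg' _ r).trans (hfplus r).symm
  refine ⟨Function.update g 0 (RingHom.comp (g 0) (σ : Aplus 0 →+* Aplus 0)), fun i r => ?_, ?_⟩
  · cases i using Fin.cases with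
    | zero =>
      rw [Function.update_self]
      exact (congrArg (g 0) (σ.commutes r)).trans (hg' 0 r)
    | succ i =>
      rw [Function.update_of_ne (Fin.succ_ne_zero i)]
      exact hg' _ r
  · rw [← hσ]
    exact chainComp_update_zero_comp g _ (Fin.last m)
end

section
/- Let p be a prime number, let R be a complete noetherian local domain with maximal ideal 𝔪, let (x_1, …, x_d) be a system of parameters of R, and let B be an R-algebra which is Cohen-Macaulay with respect to (x_1, …, x_d). Let (π_e)_{e ≥ 0} ⊆ B be a compatible system of p-th power roots of an element π = π_0 ∈ B, and let J be the ideal of B generated by all the π_e. If there exists a nonzero r ∈ R whose image in B lies in J, then J is not contained in 𝔪B; in particular B is π^{1/p^∞}-almost Cohen-Macaulay with respect to (x_1, …, x_d). -/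
theorem length_quotient_eq_add {R : Type*} [CommRing R] {I K : Ideal R} {x : R}
    (hK : ∀ b, x * b ∈ I ↔ b ∈ K) :
    Module.length R (R ⧸ I) =
      Module.length R (R ⧸ K) + Module.length R (R ⧸ I ⊔ Ideal.span {x}) := by
  let f : (R ⧸ K) →ₗ[R] (R ⧸ I) :=
    Submodule.mapQ K I (LinearMap.mulLeft R x) fun b hb => (hK b).2 hb
  let g : (R ⧸ I) →ₗ[R] (R ⧸ I ⊔ Ideal.span {x}) := Submodule.factor le_sup_left
  refine Module.length_eq_add_of_exact f g ?_ (Submodule.factor_surjective _) ?_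
  · rw [← LinearMap.ker_eq_bot, LinearMap.ker_eq_bot']
    intro b
    obtain ⟨b, rfl⟩ := Submodule.Quotient.mk_surjective _ b
    intro hb
    replace hb : Submodule.Quotient.mk (x * b) = (0 : R ⧸ I) := hb
    rw [Submodule.Quotient.mk_eq_zero] at hb
    exact (Submodule.Quotient.mk_eq_zero _).2 ((hK b).1 hb)
  · intro b
    obtain ⟨b, rfl⟩ := Submodule.Quotient.mk_surjective _ b
    change Submodule.Quotient.mk b = (0 : R ⧸ I ⊔ Ideal.span {x}) ↔ _
    rw [Submodule.Quotient.mk_eq_zero, Set.mem_range]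
    constructor
    · intro hb
      obtain ⟨i, hi, j, hj, rfl⟩ := Submodule.mem_sup.1 hb
      obtain ⟨c, rfl⟩ := Ideal.mem_span_singleton'.1 hj
      refine ⟨Submodule.Quotient.mk c, ?_⟩
      change Submodule.Quotient.mk (x * c) = (Submodule.Quotient.mk (i + c * x) : R ⧸ I)
      rw [Submodule.Quotient.eq, show x * c - (i + c * x) = -i by ring]
      exact neg_mem hi
    · rintro ⟨c, hc⟩
      obtain ⟨c, rfl⟩ := Submodule.Quotient.mk_surjective _ c
      replace hc : Submodule.Quotient.mk (x * c) = (Submodule.Quotient.mk b : R ⧸ I) := hc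
      rw [Submodule.Quotient.eq] at hc
      rw [show b = -(x * c - b) + x * c by ring]
      exact add_mem (neg_mem (Ideal.mem_sup_left hc))
        (Ideal.mul_mem_right _ _ (Ideal.mem_sup_right (Ideal.mem_span_singleton_self x)))

theorem length_quotient_anti {R : Type*} [CommRing R] {I K : Ideal R} (h : I ≤ K) :
    Module.length R (R ⧸ K) ≤ Module.length R (R ⧸ I) :=
  Module.length_le_of_surjective (Submodule.factor h) (Submodule.factor_surjective h)

theorem length_quotient_sup_pow_le {R : Type*} [CommRing R] (I : Ideal R) (x : R) (n : ℕ) :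
    Module.length R (R ⧸ I ⊔ Ideal.span {x ^ n}) ≤
      n * Module.length R (R ⧸ I ⊔ Ideal.span {x}) := by
  induction n with
  | zero =>
    have : Subsingleton (R ⧸ I ⊔ Ideal.span {x ^ 0}) := by
      rw [Submodule.Quotient.subsingleton_iff]; simp
    simp [Module.length_eq_zero]
  | succ n ih =>
    have hK : I ⊔ Ideal.span {x} ≤
        Submodule.comap (LinearMap.mulLeft R (x ^ n)) (I ⊔ Ideal.span {x ^ (n + 1)}) := by
      refine sup_le (fun b hb => Ideal.mem_sup_left (Ideal.mul_mem_left _ _ hb)) ?_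
      rw [Ideal.span_singleton_le_iff_mem, Submodule.mem_comap, LinearMap.mulLeft_apply, ← pow_succ]
      exact Ideal.mem_sup_right (Ideal.mem_span_singleton_self _)
    rw [length_quotient_eq_add (x := x ^ n) (I := I ⊔ Ideal.span {x ^ (n + 1)})
      (K := Submodule.comap (LinearMap.mulLeft R (x ^ n)) (I ⊔ Ideal.span {x ^ (n + 1)}))
      fun b => Iff.rfl, Nat.cast_succ, add_mul, one_mul,
      add_comm]
    refine add_le_add ((length_quotient_anti ?_).trans ih) (length_quotient_anti hK)
    exact sup_le_sup_right le_sup_left _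

theorem length_quotient_sup_ofList_pow_le {R : Type*} [CommRing R] (n : ℕ) (l : List R) :
    ∀ I : Ideal R, Module.length R (R ⧸ I ⊔ Ideal.ofList (l.map (· ^ n))) ≤
      n ^ l.length * Module.length R (R ⧸ I ⊔ Ideal.ofList l) := by
  induction l with
  | nil => intro I; rw [List.map_nil]; simp
  | cons u l ih =>
    intro I
    rw [List.map_cons, Ideal.ofList_cons, Ideal.ofList_cons, List.length_cons, sup_left_comm,
      sup_comm, pow_succ', mul_assoc, ← sup_assoc]
    refine (length_quotient_sup_pow_le _ _ _).trans ?_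
    gcongr
    rw [sup_right_comm]
    exact ih _

/-- `l` is a weakly regular sequence on `B ⧸ I`. -/
def IsWeaklyRegularMod {B : Type*} [CommRing B] : Ideal B → List B → Prop
  | _, [] => True
  | I, u :: l => (∀ b, u * b ∈ I → b ∈ I) ∧ IsWeaklyRegularMod (I ⊔ Ideal.span {u}) l

section

variable {B : Type*} [CommRing B] {I : Ideal B} {u v : B}

theorem mem_of_pow_mul_mem (hu : ∀ b, u * b ∈ I → b ∈ I) (n : ℕ) :
    ∀ b, u ^ n * b ∈ I → b ∈ I := by
  induction n with
  | zero => simp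
  | succ n ih => exact fun b hb => ih b (hu _ (by rwa [← mul_assoc, ← pow_succ']))

theorem mem_sup_span_of_mul_mem (hu : ∀ b, u * b ∈ I → b ∈ I)
    (hv : ∀ b, v * b ∈ I ⊔ Ideal.span {u} → b ∈ I ⊔ Ideal.span {u}) :
    ∀ b, u * b ∈ I ⊔ Ideal.span {v} → b ∈ I ⊔ Ideal.span {v} := by
  intro b hb
  obtain ⟨i, hi, j, hj, hij⟩ := Submodule.mem_sup.1 hb
  obtain ⟨c, rfl⟩ := Ideal.mem_span_singleton'.1 hj
  have hc : v * c ∈ I ⊔ Ideal.span {u} := by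
    rw [show v * c = -i + u * b by linear_combination hij]
    exact add_mem (neg_mem (Ideal.mem_sup_left hi)) (Ideal.mul_mem_right _ _
      (Ideal.mem_sup_right (Ideal.mem_span_singleton_self u)))
  obtain ⟨i', hi', j', hj', hc'⟩ := Submodule.mem_sup.1 (hv c hc)
  obtain ⟨w, rfl⟩ := Ideal.mem_span_singleton'.1 hj'
  have h1 : b - v * w ∈ I := by
    refine hu _ ?_
    rw [show u * (b - v * w) = i + v * i' by linear_combination -hij - v * hc']
    exact add_mem hi (Ideal.mul_mem_left _ _ hi')
  rw [← sub_add_cancel b (v * w)]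
  exact add_mem (Ideal.mem_sup_left h1) (Ideal.mul_mem_right _ _
    (Ideal.mem_sup_right (Ideal.mem_span_singleton_self v)))

theorem mem_sup_span_pow_of_mul_mem (hu : ∀ b, u * b ∈ I → b ∈ I)
    (hv : ∀ b, v * b ∈ I ⊔ Ideal.span {u} → b ∈ I ⊔ Ideal.span {u}) (n : ℕ) :
    ∀ b, v * b ∈ I ⊔ Ideal.span {u ^ n} → b ∈ I ⊔ Ideal.span {u ^ n} := by
  induction n with
  | zero => simp
  | succ n ih =>
    intro b hb
    have hle : I ⊔ Ideal.span {u ^ (n + 1)} ≤ I ⊔ Ideal.span {u} :=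
      sup_le_sup_left (Ideal.span_singleton_le_span_singleton.2 (dvd_pow_self u n.succ_ne_zero)) _
    obtain ⟨i, hi, j, hj, rfl⟩ := Submodule.mem_sup.1 (hv b (hle hb))
    obtain ⟨c, rfl⟩ := Ideal.mem_span_singleton'.1 hj
    obtain ⟨k, hk, j, hj, hkj⟩ := Submodule.mem_sup.1 hb
    obtain ⟨w, rfl⟩ := Ideal.mem_span_singleton'.1 hj
    have h1 : v * c - w * u ^ n ∈ I := by
      refine hu _ ?_
      rw [show u * (v * c - w * u ^ n) = k - v * i by linear_combination -hkj]
      exact sub_mem hk (Ideal.mul_mem_left _ _ hi)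
    have h2 : v * c ∈ I ⊔ Ideal.span {u ^ n} := by
      rw [← sub_add_cancel (v * c) (w * u ^ n)]
      exact add_mem (Ideal.mem_sup_left h1) (Ideal.mul_mem_left _ _
        (Ideal.mem_sup_right (Ideal.mem_span_singleton_self _)))
    obtain ⟨i', hi', j', hj', rfl⟩ := Submodule.mem_sup.1 (ih c h2)
    obtain ⟨z, rfl⟩ := Ideal.mem_span_singleton'.1 hj'
    rw [show i + (i' + z * u ^ n) * u = (i + i' * u) + z * u ^ (n + 1) by ring]
    exact add_mem (Ideal.mem_sup_left (add_mem hi (Ideal.mul_mem_right _ _ hi')))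
      (Ideal.mul_mem_left _ _ (Ideal.mem_sup_right (Ideal.mem_span_singleton_self _)))

theorem IsWeaklyRegularMod.sup_span_pow {l : List B} (n : ℕ) :
    ∀ {I : Ideal B}, (∀ b, u * b ∈ I → b ∈ I) → IsWeaklyRegularMod (I ⊔ Ideal.span {u}) l →
      IsWeaklyRegularMod (I ⊔ Ideal.span {u ^ n}) l := by
  induction l with
  | nil => exact fun _ _ => trivial
  | cons v l ih =>
    intro I hu hl
    refine ⟨mem_sup_span_pow_of_mul_mem hu hl.1 n, ?_⟩
    rw [sup_right_comm]
    refine ih (mem_sup_span_of_mul_mem hu hl.1) ?_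
    rw [sup_right_comm]
    exact hl.2

theorem IsWeaklyRegularMod.mem_of_mul_mem {l : List B} (n : ℕ) :
    ∀ {I : Ideal B}, IsWeaklyRegularMod I (u :: l) →
      ∀ b, u * b ∈ I ⊔ Ideal.ofList (l.map (· ^ n)) → b ∈ I ⊔ Ideal.ofList (l.map (· ^ n)) := by
  induction l with
  | nil => intro I hl; simpa using hl.1
  | cons v l ih =>
    intro I hl
    rw [List.map_cons, Ideal.ofList_cons, ← sup_assoc]
    refine ih ⟨mem_sup_span_of_mul_mem hl.1 (mem_of_pow_mul_mem hl.2.1 n), ?_⟩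
    rw [sup_right_comm]
    exact hl.2.2.sup_span_pow n hl.2.1

theorem isWeaklyRegularMod_ofFn {m : ℕ} : ∀ {I : Ideal B} {y : Fin m → B},
    (∀ i, ∀ b, y i * b ∈ I ⊔ Ideal.span (y '' {j | j < i}) →
      b ∈ I ⊔ Ideal.span (y '' {j | j < i})) → IsWeaklyRegularMod I (List.ofFn y) := by
  induction m with
  | zero => intro I y _; simp [IsWeaklyRegularMod]
  | succ m ih =>
    intro I y h
    rw [List.ofFn_succ]
    refine ⟨by simpa using h 0, ih fun i => ?_⟩
    have : y '' {j | j < i.succ} = insert (y 0) ((fun k => y k.succ) '' {j | j < i}) := by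
      ext z
      simp [Fin.exists_fin_succ, eq_comm]
    have hi := h i.succ
    rwa [this, Ideal.span_insert, ← sup_assoc] at hi

theorem natCast_mul_length_le {R : Type*} [CommRing R] [Algebra R B] {x : R}
    (hx : ∀ b, algebraMap R B x * b ∈ I → b ∈ I) (n : ℕ) :
    n * Module.length R (R ⧸ (I ⊔ Ideal.span {algebraMap R B x}).comap (algebraMap R B)) ≤
      Module.length R (R ⧸ (I ⊔ Ideal.span {algebraMap R B x ^ n}).comap (algebraMap R B)) := by
  induction n with
  | zero => simp
  | succ n ih =>
    rw [Nat.cast_succ, add_mul, one_mul,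
      add_comm, length_quotient_eq_add (x := x ^ n)
        (I := (I ⊔ Ideal.span {algebraMap R B x ^ (n + 1)}).comap (algebraMap R B))
        (K := Submodule.comap (LinearMap.mulLeft R (x ^ n))
          ((I ⊔ Ideal.span {algebraMap R B x ^ (n + 1)}).comap (algebraMap R B)))
        fun b => Iff.rfl]
    refine add_le_add (length_quotient_anti ?_) (ih.trans (length_quotient_anti ?_))
    · intro b hb
      have hb : algebraMap R B (x ^ n * b) ∈ I ⊔ Ideal.span {algebraMap R B x ^ (n + 1)} := hb
      obtain ⟨i, hi, j, hj, hij⟩ := Submodule.mem_sup.1 hb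
      obtain ⟨c, rfl⟩ := Ideal.mem_span_singleton'.1 hj
      have h1 : algebraMap R B b - c * algebraMap R B x ∈ I := by
        refine mem_of_pow_mul_mem hx n _ ?_
        rw [map_mul, map_pow] at hij
        rwa [show algebraMap R B x ^ n * (algebraMap R B b - c * algebraMap R B x) = i by
          linear_combination -hij]
      rw [Ideal.mem_comap, ← sub_add_cancel (algebraMap R B b) (c * algebraMap R B x)]
      exact add_mem (Ideal.mem_sup_left h1) (Ideal.mul_mem_left _ _
        (Ideal.mem_sup_right (Ideal.mem_span_singleton_self _)))
    · refine sup_le (Ideal.comap_mono (sup_le_sup_left ?_ _)) ?_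
      · exact Ideal.span_singleton_le_span_singleton.2 (pow_dvd_pow _ n.le_succ)
      · rw [Ideal.span_singleton_le_iff_mem, Ideal.mem_comap, map_pow]
        exact Ideal.mem_sup_right (Ideal.mem_span_singleton_self _)

theorem IsWeaklyRegularMod.pow_length_le {R : Type*} [CommRing R] [Algebra R B] (n : ℕ)
    {l : List R} : ∀ {I : Ideal B}, IsWeaklyRegularMod I (l.map (algebraMap R B)) →
    I ⊔ Ideal.ofList (l.map (algebraMap R B)) ≠ ⊤ →
    (n : ℕ∞) ^ l.length ≤ Module.length R
      (R ⧸ (I ⊔ Ideal.ofList ((l.map (algebraMap R B)).map (· ^ n))).comap (algebraMap R B)) := by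
  induction l with
  | nil =>
    intro I _ hI
    have : Nontrivial (R ⧸ I.comap (algebraMap R B)) :=
      Ideal.Quotient.nontrivial_iff.2 (by simpa using hI)
    simpa [Order.one_le_iff_ne_zero, Module.length_eq_zero_iff, not_subsingleton_iff_nontrivial]
  | cons u l ih =>
    intro I hl hI
    rw [List.map_cons, Ideal.ofList_cons, ← sup_assoc] at hI
    have h1 := ih hl.2 hI
    have h2 := natCast_mul_length_le (hl.mem_of_mul_mem n) n
    rw [List.map_cons, List.map_cons, Ideal.ofList_cons, sup_left_comm, sup_comm,
      List.length_cons, pow_succ']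
    refine le_trans ?_ h2
    gcongr
    rwa [sup_right_comm]

theorem ofList_pow_le (n : ℕ) (l : List B) :
    Ideal.ofList l ^ (l.length * n + 1) ≤ Ideal.ofList (l.map (· ^ n)) := by
  induction l with
  | nil => simp
  | cons u l ih =>
    rw [List.map_cons, Ideal.ofList_cons, Ideal.ofList_cons, List.length_cons,
      show (l.length + 1) * n + 1 = n + (l.length * n + 1) by ring]
    refine Ideal.sup_pow_add_le_pow_sup_pow.trans (sup_le_sup ?_ ih)
    rw [Ideal.span_singleton_pow]

end

theorem length_quotient_ne_top {R : Type*} [CommRing R] [IsNoetherianRing R] [IsLocalRing R]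
    {I : Ideal R} (hI : IsLocalRing.maximalIdeal R ≤ I.radical) :
    Module.length R (R ⧸ I) ≠ ⊤ := by
  have : IsArtinianRing (R ⧸ I) := by
    rw [isArtinianRing_iff_krullDimLE_zero, Ring.krullDimLE_zero_iff]
    intro P hP
    have h1 : I ≤ P.comap (Ideal.Quotient.mk I) := fun a ha => by
      rw [Ideal.mem_comap, Ideal.Quotient.eq_zero_iff_mem.2 ha]; exact P.zero_mem
    have h2 : IsLocalRing.maximalIdeal R ≤ P.comap (Ideal.Quotient.mk I) :=
      hI.trans ((Ideal.IsPrime.radical_le_iff inferInstance).2 h1)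
    have h3 := (IsLocalRing.maximalIdeal.isMaximal R).eq_of_le
      (Ideal.IsPrime.ne_top inferInstance) h2
    have : (P.comap (Ideal.Quotient.mk I)).IsMaximal := h3 ▸ inferInstance
    exact Ideal.isMaximal_of_isIntegral_of_isMaximal_comap' _
      (RingHom.isIntegral_of_surjective _ Ideal.Quotient.mk_surjective) P this
  have : IsArtinian R (R ⧸ I) :=
    isArtinian_of_surjective_algebraMap (Ideal.Quotient.mk_surjective (I := I))
  exact Module.length_ne_top

theorem exists_list_maximalIdeal_le_radical {R : Type*} [CommRing R] [IsDomain R]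
    [IsNoetherianRing R] [IsLocalRing R] {r : R} (hr : r ≠ 0)
    (hr' : r ∈ IsLocalRing.maximalIdeal R) :
    ∃ l : List R, ((l.length + 1 : ℕ) : WithBot ℕ∞) = ringKrullDim R ∧
      (∀ y ∈ l, y ∈ IsLocalRing.maximalIdeal R) ∧
      IsLocalRing.maximalIdeal R ≤ (Ideal.span {r} ⊔ Ideal.ofList l).radical := by
  have : Nontrivial (R ⧸ Ideal.span {r}) := Ideal.Quotient.nontrivial_iff.2
    (by rwa [Ne, Ideal.span_singleton_eq_top])
  have hdim := ringKrullDim_quotient_span_singleton_succ_eq_ringKrullDim_of_mem_nonZeroDivisors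
    (mem_nonZeroDivisors_of_ne_zero hr) hr'
  have : IsLocalRing (R ⧸ Ideal.span {r}) :=
    IsLocalRing.of_surjective' _ Ideal.Quotient.mk_surjective
  obtain ⟨s, hs, hcard⟩ := Ideal.exists_finset_card_eq_height_of_isNoetherianRing
    (IsLocalRing.maximalIdeal (R ⧸ Ideal.span {r}))
  have hmax : IsLocalRing.maximalIdeal (R ⧸ Ideal.span {r}) ≤ (Ideal.span (s : Set _)).radical := by
    rw [Ideal.radical_eq_sInf]
    refine le_sInf fun P ⟨hP, hP'⟩ => ?_
    exact hs.2 ⟨hP', hP⟩ (IsLocalRing.le_maximalIdeal hP'.ne_top)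
  have hcomap : (IsLocalRing.maximalIdeal (R ⧸ Ideal.span {r})).comap
      (Ideal.Quotient.mk (Ideal.span {r})) = IsLocalRing.maximalIdeal R := by
    have := Ideal.comap_isMaximal_of_surjective (Ideal.Quotient.mk (Ideal.span {r}))
      Ideal.Quotient.mk_surjective (K := IsLocalRing.maximalIdeal _)
    exact IsLocalRing.eq_maximalIdeal this
  have hmap : s.toList.map (fun z => Ideal.Quotient.mk (Ideal.span {r}) z.out) = s.toList := by
    simp
  refine ⟨s.toList.map Quotient.out, ?_, ?_, ?_⟩
  · rw [List.length_map, Finset.length_toList, ← hdim,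
      ← IsLocalRing.maximalIdeal_height_eq_ringKrullDim, ← hcard]
    rfl
  · intro y hy
    obtain ⟨z, hz, rfl⟩ := List.mem_map.1 hy
    rw [← hcomap, Ideal.mem_comap, Ideal.Quotient.mk_out]
    exact hs.1.2 (Ideal.subset_span (Finset.mem_toList.1 hz))
  · have h := Ideal.comap_mono (f := Ideal.Quotient.mk (Ideal.span {r})) hmax
    rw [hcomap, Ideal.comap_radical] at h
    convert h using 2
    rw [← Ideal.comap_map_mk (le_sup_left : _ ≤ Ideal.span {r} ⊔ Ideal.ofList _), Ideal.map_sup,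
      Ideal.map_quotient_self, bot_sup_eq, Ideal.map_ofList, List.map_map]
    refine congrArg (Ideal.comap _) ((congrArg Ideal.ofList hmap).trans ?_)
    rw [Ideal.ofList]
    congr 1
    ext z
    simp

theorem span_range_le_pow_of_le {B : Type*} [CommRing B] {p : ℕ} (hp : 1 < p) {I : Ideal B}
    {π : ℕ → B} (hπ : ∀ e : ℕ, π (e + 1) ^ p = π e) (h : Ideal.span (Set.range π) ≤ I) (k : ℕ) :
    Ideal.span (Set.range π) ≤ I ^ k := by
  have hpow : ∀ k e, π (e + k) ^ p ^ k = π e := by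
    intro k
    induction k with
    | zero => simp
    | succ k ih => intro e; rw [pow_succ', pow_mul, ← add_assoc, hπ, ih]
  rw [Ideal.span_le]
  rintro _ ⟨e, rfl⟩
  rw [← hpow k e]
  exact Ideal.pow_le_pow_right (Nat.lt_pow_self hp).le
    (Ideal.pow_mem_pow (h (Ideal.subset_span ⟨_, rfl⟩)) _)

theorem ofList_ofFn {R : Type*} [CommRing R] {m : ℕ} (y : Fin m → R) :
    Ideal.ofList (List.ofFn y) = Ideal.span (Set.range y) := by
  rw [Ideal.ofList]
  congr 1
  ext
  simp

/-- If `B` is Cohen-Macaulay with respect to a system of parameters of the noetherian local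
domain `R`, then the `𝔪`-adic topology of `B` separates nonzero elements of `R` from zero. -/
theorem IsCMwrt.eq_zero_of_forall_mem_pow {R B : Type*} [CommRing R] [IsDomain R]
    [IsNoetherianRing R] [IsLocalRing R] [CommRing B] [Algebra R B] {d : ℕ} {x : Fin d → R}
    (hx : IsSOP R x) (hCM : IsCMwrt (algebraMap R B) x) {r : R}
    (hr : ∀ k, algebraMap R B r ∈
      (IsLocalRing.maximalIdeal R).map (algebraMap R B) ^ k) : r = 0 := by
  by_contra hr0
  obtain ⟨hdim, -, hrad⟩ := hx
  have hmapx : (List.ofFn x).map (algebraMap R B) = List.ofFn fun i => algebraMap R B (x i) := by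
    rw [List.map_ofFn]; rfl
  have hwr : IsWeaklyRegularMod (⊥ : Ideal B) ((List.ofFn x).map (algebraMap R B)) := by
    rw [hmapx]
    refine isWeaklyRegularMod_ofFn fun i => ?_
    rw [bot_sup_eq]
    exact hCM.1 i
  have hne : ⊥ ⊔ Ideal.ofList ((List.ofFn x).map (algebraMap R B)) ≠ ⊤ := by
    rw [hmapx, ofList_ofFn, bot_sup_eq]
    exact hCM.2
  obtain ⟨c, hc⟩ := Ideal.exists_radical_pow_le_of_fg (Ideal.span (Set.range x))
    (IsNoetherian.noetherian _)
  rw [hrad, ← ofList_ofFn] at hc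
  have hr1 : r ∈ IsLocalRing.maximalIdeal R := by
    by_contra hu
    rw [IsLocalRing.mem_maximalIdeal, mem_nonunits_iff, not_not] at hu
    have h1 := Ideal.eq_top_of_isUnit_mem _ (hr c) (hu.map _)
    rw [← Ideal.map_pow] at h1
    apply hne
    rw [bot_sup_eq, ← Ideal.map_ofList, eq_top_iff, ← h1]
    exact Ideal.map_mono hc
  obtain ⟨l, hl, hlm, hlr⟩ := exists_list_maximalIdeal_le_radical hr0 hr1
  have hd : d = l.length + 1 := by
    rw [← hl] at hdim
    exact_mod_cast hdim
  have hfin := length_quotient_ne_top hlr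
  obtain ⟨L, hL⟩ := ENat.ne_top_iff_exists.1 hfin
  have key (n : ℕ) : n ^ d ≤ (c * (d * n + 1)) ^ l.length * L := by
    have hpow : IsLocalRing.maximalIdeal R ^ (c * (d * n + 1)) ≤
        Ideal.ofList ((List.ofFn x).map (· ^ n)) := by
      rw [pow_mul]
      refine (Ideal.pow_right_mono hc _).trans ?_
      simpa using ofList_pow_le n (List.ofFn x)
    have hmap : (Ideal.ofList ((List.ofFn x).map (· ^ n))).map (algebraMap R B) =
        Ideal.ofList (((List.ofFn x).map (algebraMap R B)).map (· ^ n)) := by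
      rw [Ideal.map_ofList, List.map_map, List.map_map]
      congr 2
      ext
      simp
    have hle : Ideal.span {r} ⊔ Ideal.ofList (l.map (· ^ (c * (d * n + 1)))) ≤
        (⊥ ⊔ Ideal.ofList (((List.ofFn x).map (algebraMap R B)).map (· ^ n))).comap
          (algebraMap R B) := by
      rw [bot_sup_eq, ← hmap]
      refine sup_le ?_ (le_trans ?_ Ideal.le_comap_map)
      · rw [Ideal.span_singleton_le_iff_mem, Ideal.mem_comap]
        refine Ideal.map_mono hpow ?_
        rw [Ideal.map_pow]
        exact hr _
      · refine Ideal.span_le.2 fun z hz => ?_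
        obtain ⟨y, hy, rfl⟩ := List.mem_map.1 hz
        exact hpow (Ideal.pow_mem_pow (hlm y hy) _)
    have h1 := hwr.pow_length_le n hne
    have h2 := length_quotient_sup_ofList_pow_le (c * (d * n + 1)) l (Ideal.span {r})
    have h3 := h1.trans ((length_quotient_anti hle).trans h2)
    rw [List.length_ofFn, ← hL] at h3
    exact_mod_cast h3
  set A := (c * (d + 1)) ^ l.length * L
  have h1 := key (A + 1)
  have h2 : (c * (d * (A + 1) + 1)) ^ l.length * L ≤ (A + 1) ^ l.length * A := by
    calc (c * (d * (A + 1) + 1)) ^ l.length * L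
        ≤ (c * (d * (A + 1) + (A + 1))) ^ l.length * L := by gcongr; omega
      _ = (A + 1) ^ l.length * A := by
        rw [show c * (d * (A + 1) + (A + 1)) = (A + 1) * (c * (d + 1)) by ring, mul_pow, mul_assoc]
  have h3 : (A + 1) ^ d = (A + 1) ^ l.length * (A + 1) := by rw [hd, pow_succ]
  rw [h3] at h1
  have h4 := Nat.le_of_mul_le_mul_left (h1.trans h2) (by positivity)
  omega

/-- **Proposition 2.3 (1)**: a Cohen-Macaulay algebra `B` (w.r.t. a system of parameters `x`)
over a complete noetherian local domain `R`, containing a compatible system of `p`-th power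
roots `π_e` whose ideal `J` meets `R` nontrivially, satisfies `J ⊄ 𝔪B`; in particular `B` is
`π^{1/p^∞}`-almost Cohen-Macaulay w.r.t. `x`. -/
theorem almost_CM_of_CM
    (p : ℕ) (hp : p.Prime)
    (R : Type) [CommRing R] [IsDomain R] [IsNoetherianRing R] [IsLocalRing R]
    [IsAdicComplete (IsLocalRing.maximalIdeal R) R]
    (B : Type) [CommRing B] [Algebra R B]
    (d : ℕ) (x : Fin d → R) (hx : IsSOP R x)
    (hCM : IsCMwrt (algebraMap R B) x)
    (π : ℕ → B) (hπ : ∀ e : ℕ, π (e + 1) ^ p = π e)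
    (r : R) (hr : r ≠ 0) (hrJ : algebraMap R B r ∈ Ideal.span (Set.range π)) :
    ¬ Ideal.span (Set.range π) ≤
        Ideal.map (algebraMap R B) (IsLocalRing.maximalIdeal R) ∧
      IsAlmostCMwrt (algebraMap R B) π x := by
  have h : ¬ Ideal.span (Set.range π) ≤
      Ideal.map (algebraMap R B) (IsLocalRing.maximalIdeal R) := fun h =>
    hr (hCM.eq_zero_of_forall_mem_pow hx fun k => span_range_le_pow_of_le hp.one_lt hπ h k hrJ)
  refine ⟨h, fun i b hb e => Ideal.mul_mem_left _ _ (hCM.1 i b hb), fun h' => h (h'.trans ?_)⟩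
  rw [Ideal.span_le]
  rintro _ ⟨i, rfl⟩
  exact Ideal.mem_map_of_mem _ (hx.2.1 i)
end

section
/- Let p be a prime number, let R be a complete noetherian local domain with maximal ideal 𝔪, let (x_1, …, x_d) be a system of parameters of R, and let B be an R-algebra which is Cohen-Macaulay with respect to (x_1, …, x_d). Let (π_e)_{e ≥ 0} ⊆ B be a compatible system of p-th power roots of an element π = π_0 ∈ B, and let J be the ideal of B generated by all the π_e. Let 𝔭 be a prime ideal of R, and suppose there exists r ∈ R with r ∉ 𝔭 whose image in B lies in J. Then J is not contained in 𝔪B + √(𝔭B), where √(𝔭B) denotes the radical of the ideal generated by the image of 𝔭 in B; that is, the quotient B/(𝔪B + √(𝔭B)) is not π^{1/p^∞}-almost zero. -/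
universe u v

/-- `z` is a weakly regular sequence on `B ⧸ N`. -/
def IsWeaklyRegSeqMod {B : Type*} [CommRing B] : (n : ℕ) → (Fin n → B) → Ideal B → Prop
  | 0, _, _ => True
  | n + 1, z, N =>
    (∀ b, z 0 * b ∈ N → b ∈ N) ∧
      IsWeaklyRegSeqMod n (fun i => z i.succ) (N ⊔ Ideal.span {z 0})

section RegularSequences

variable {B : Type*} [CommRing B]

lemma Ideal.span_range_fin_succ {n : ℕ} (z : Fin (n + 1) → B) :
    Ideal.span (Set.range z) =
      Ideal.span {z 0} ⊔ Ideal.span (Set.range fun i : Fin n => z i.succ) := by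
  rw [Fin.range_fin_succ, Ideal.span_insert]
  rfl

lemma Ideal.mul_mem_sup_span_singleton_iff {N N' : Ideal B} {u z : B}
    (hN : ∀ b, u * b ∈ N' ↔ b ∈ N)
    (hz : ∀ b, z * b ∈ N' ⊔ Ideal.span {u} → b ∈ N' ⊔ Ideal.span {u}) (b : B) :
    u * b ∈ N' ⊔ Ideal.span {z} ↔ b ∈ N ⊔ Ideal.span {z} := by
  constructor
  · intro h
    obtain ⟨a, ha, c, hc, hac⟩ := Submodule.mem_sup.1 h
    obtain ⟨c, rfl⟩ := Ideal.mem_span_singleton'.1 hc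
    have hc' : z * c ∈ N' ⊔ Ideal.span {u} := by
      have : z * c = -a + b * u := by linear_combination hac
      rw [this]
      exact Submodule.add_mem_sup (N'.neg_mem ha) (Ideal.mem_span_singleton'.2 ⟨b, rfl⟩)
    obtain ⟨a', ha', e, he, hae⟩ := Submodule.mem_sup.1 (hz c hc')
    obtain ⟨e, rfl⟩ := Ideal.mem_span_singleton'.1 he
    have hb : b - z * e ∈ N := by
      rw [← hN]
      have : u * (b - z * e) = a + z * a' := by linear_combination -hac - z * hae
      rw [this]
      exact N'.add_mem ha (N'.mul_mem_left _ ha')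
    rw [show b = (b - z * e) + e * z by ring]
    exact Submodule.add_mem_sup hb (Ideal.mem_span_singleton'.2 ⟨e, rfl⟩)
  · intro h
    obtain ⟨a, ha, c, hc, rfl⟩ := Submodule.mem_sup.1 h
    rw [mul_add]
    exact Submodule.add_mem_sup ((hN a).2 ha) (Ideal.mul_mem_left _ _ hc)

lemma Ideal.sup_span_pow_succ_sup_span (N : Ideal B) (u : B) (k : ℕ) :
    N ⊔ Ideal.span {u ^ (k + 1)} ⊔ Ideal.span {u} = N ⊔ Ideal.span {u} := by
  rw [sup_assoc, sup_eq_right.2 ((Ideal.span_singleton_le_span_singleton (x := u ^ (k + 1))).2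
    (dvd_pow_self u k.succ_ne_zero))]

namespace IsWeaklyRegSeqMod

lemma mul_mem_iff : ∀ {n : ℕ} {z : Fin n → B} {N N' : Ideal B} {u : B},
    (∀ b, u * b ∈ N' ↔ b ∈ N) → IsWeaklyRegSeqMod n z (N' ⊔ Ideal.span {u}) →
    ∀ b, u * b ∈ N' ⊔ Ideal.span (Set.range z) ↔ b ∈ N ⊔ Ideal.span (Set.range z)
  | 0, z, N, N', u, hN, _, b => by simpa using hN b
  | n + 1, z, N, N', u, hN, hz, b => by
    rw [Ideal.span_range_fin_succ, ← sup_assoc, ← sup_assoc]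
    refine mul_mem_iff (Ideal.mul_mem_sup_span_singleton_iff hN hz.1) ?_ b
    rw [sup_right_comm]
    exact hz.2

lemma of_extension : ∀ {n : ℕ} {z : Fin n → B} {N N' : Ideal B} {u : B},
    (∀ b, u * b ∈ N' ↔ b ∈ N) → IsWeaklyRegSeqMod n z N →
    IsWeaklyRegSeqMod n z (N' ⊔ Ideal.span {u}) → IsWeaklyRegSeqMod n z N'
  | 0, _, _, _, _, _, _, _ => trivial
  | n + 1, z, N, N', u, hN, hz, hz' => by
    refine ⟨fun b hb => ?_, ?_⟩
    · obtain ⟨a, ha, e, he, rfl⟩ := Submodule.mem_sup.1 (hz'.1 b (Ideal.mem_sup_left hb))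
      obtain ⟨e, rfl⟩ := Ideal.mem_span_singleton'.1 he
      have h : u * (z 0 * e) ∈ N' := by
        have : u * (z 0 * e) = z 0 * (a + e * u) - z 0 * a := by ring
        rw [this]
        exact N'.sub_mem hb (N'.mul_mem_left _ ha)
      have := (hN e).2 (hz.1 e ((hN _).1 h))
      exact N'.add_mem ha (by rwa [mul_comm])
    · refine of_extension (Ideal.mul_mem_sup_span_singleton_iff hN hz'.1) hz.2 ?_
      rw [sup_right_comm]
      exact hz'.2

lemma mul_mem_sup_span_pow_succ {N : Ideal B} {u : B} (hu : ∀ b, u * b ∈ N → b ∈ N) (k : ℕ)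
    (b : B) : u * b ∈ N ⊔ Ideal.span {u ^ (k + 1)} ↔ b ∈ N ⊔ Ideal.span {u ^ k} := by
  constructor
  · intro h
    obtain ⟨a, ha, c, hc, hac⟩ := Submodule.mem_sup.1 h
    obtain ⟨c, rfl⟩ := Ideal.mem_span_singleton'.1 hc
    rw [show b = (b - c * u ^ k) + c * u ^ k by ring]
    refine Submodule.add_mem_sup (hu _ ?_) (Ideal.mem_span_singleton'.2 ⟨c, rfl⟩)
    rwa [show u * (b - c * u ^ k) = a by linear_combination -hac]
  · intro h
    obtain ⟨a, ha, c, hc, rfl⟩ := Submodule.mem_sup.1 h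
    obtain ⟨c, rfl⟩ := Ideal.mem_span_singleton'.1 hc
    rw [mul_add]
    exact Submodule.add_mem_sup (N.mul_mem_left _ ha) (Ideal.mem_span_singleton'.2 ⟨c, by ring⟩)

lemma of_eq_top : ∀ {n : ℕ} {z : Fin n → B}, IsWeaklyRegSeqMod n z ⊤
  | 0, _ => trivial
  | n + 1, z => ⟨fun _ _ => trivial, by rw [top_sup_eq]; exact of_eq_top⟩

lemma sup_span_pow {n : ℕ} {z : Fin n → B} {N : Ideal B} {u : B}
    (hu : ∀ b, u * b ∈ N → b ∈ N) (hz : IsWeaklyRegSeqMod n z (N ⊔ Ideal.span {u})) :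
    ∀ k : ℕ, IsWeaklyRegSeqMod n z (N ⊔ Ideal.span {u ^ k})
  | 0 => by simpa using of_eq_top
  | k + 1 => by
    refine of_extension (mul_mem_sup_span_pow_succ hu k) (sup_span_pow hu hz k) ?_
    rwa [Ideal.sup_span_pow_succ_sup_span]

lemma pow : ∀ {n : ℕ} {z : Fin n → B} {N : Ideal B}, IsWeaklyRegSeqMod n z N →
    ∀ k : ℕ, IsWeaklyRegSeqMod n (fun i => z i ^ k) N
  | 0, _, _, _, _ => trivial
  | n + 1, z, N, h, k => by
    refine ⟨fun b hb => ?_, pow (sup_span_pow h.1 h.2 k) k⟩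
    dsimp only at hb
    induction k with
    | zero => simpa using hb
    | succ k ih => exact ih (h.1 _ (by rwa [← mul_assoc, ← pow_succ']))

/-- Multiplication by the product of a weakly regular sequence maps `B ⧸ (zᵢᵏ)` injectively into
`B ⧸ (zᵢᵏ⁺¹)`. -/
lemma mem_of_prod_mul_mem : ∀ {n : ℕ} {z : Fin n → B} {N : Ideal B}, IsWeaklyRegSeqMod n z N →
    ∀ (k : ℕ) (b : B), (∏ i, z i) * b ∈ N ⊔ Ideal.span (Set.range fun i => z i ^ (k + 1)) →
      b ∈ N ⊔ Ideal.span (Set.range fun i => z i ^ k)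
  | 0, z, N, _, k, b, hb => by simpa using hb
  | n + 1, z, N, h, k, b, hb => by
    rw [Ideal.span_range_fin_succ, ← sup_assoc] at hb ⊢
    rw [Fin.prod_univ_succ, mul_comm (z 0), mul_assoc] at hb
    have h1 := mem_of_prod_mul_mem (sup_span_pow h.1 h.2 (k + 1)) k _ hb
    refine (mul_mem_iff (mul_mem_sup_span_pow_succ h.1 k) ?_ b).1 h1
    refine pow (z := fun i : Fin n => z i.succ) ?_ k
    rw [Ideal.sup_span_pow_succ_sup_span]
    exact h.2

lemma of_forall : ∀ {n : ℕ} {z : Fin n → B} {N : Ideal B},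
    (∀ i b, z i * b ∈ N ⊔ Ideal.span (z '' {j | j < i}) → b ∈ N ⊔ Ideal.span (z '' {j | j < i})) →
    IsWeaklyRegSeqMod n z N
  | 0, _, _, _ => trivial
  | n + 1, z, N, h => by
    refine ⟨fun b hb => by simpa using h 0 b (by simpa using hb), of_forall fun i b => ?_⟩
    have hs : z '' {j | j < i.succ} = insert (z 0) ((fun i : Fin n => z i.succ) '' {j | j < i}) := by
      ext y
      constructor
      · rintro ⟨j, hj, rfl⟩
        cases j using Fin.cases with
        | zero => exact Or.inl rfl
        | succ j => exact Or.inr ⟨j, Fin.succ_lt_succ_iff.1 hj, rfl⟩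
      · rintro (rfl | ⟨j, hj, rfl⟩)
        · exact ⟨0, Fin.succ_pos i, rfl⟩
        · exact ⟨j.succ, Fin.succ_lt_succ_iff.2 hj, rfl⟩
    have := h i.succ b
    rwa [hs, Ideal.span_insert, ← sup_assoc] at this

end IsWeaklyRegSeqMod

end RegularSequences

section InjectiveHull

variable {R : Type*} [CommRing R] {E : Type*} [AddCommGroup E] [Module R E]

/-- `F` is an essential extension of its submodule `K`. -/
def Submodule.IsEssentialExt (K F : Submodule R E) : Prop :=
  K ≤ F ∧ ∀ x ∈ F, x ≠ 0 → ∃ r : R, r • x ∈ K ∧ r • x ≠ 0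

lemma Submodule.exists_maximal_isEssentialExt (K : Submodule R E) :
    ∃ F, Maximal (K.IsEssentialExt) F := by
  obtain ⟨F, -, hF⟩ := zorn_le_nonempty₀ {F | K.IsEssentialExt F} (fun c hc hchain F₀ hF₀ => by
    refine ⟨sSup c, ⟨(hc hF₀).1.trans (le_sSup hF₀), fun x hx hx0 => ?_⟩, fun z hz => le_sSup hz⟩
    obtain ⟨F, hF, hxF⟩ := (Submodule.mem_sSup_of_directed ⟨F₀, hF₀⟩ hchain.directedOn).1 hx
    exact (hc hF).2 x hxF hx0) K ⟨le_rfl, fun x hx hx0 => ⟨1, by simpa using hx, by simpa using hx0⟩⟩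
  exact ⟨F, hF⟩

lemma Submodule.exists_maximal_disjoint (F : Submodule R E) :
    ∃ N, Maximal (fun N => Disjoint N F) N := by
  obtain ⟨N, -, hN⟩ := zorn_le_nonempty₀ {N | Disjoint N F} (fun c hc hchain N₀ hN₀ => by
    refine ⟨sSup c, Submodule.disjoint_def.2 fun x hx hxF => ?_, fun z hz => le_sSup hz⟩
    obtain ⟨N, hN, hxN⟩ := (Submodule.mem_sSup_of_directed ⟨N₀, hN₀⟩ hchain.directedOn).1 hx
    exact Submodule.disjoint_def.1 (hc hN) x hxN hxF) ⊥ disjoint_bot_left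
  exact ⟨N, hN⟩

/-- A maximal essential extension inside an injective module is a retract. -/
lemma Submodule.exists_retraction [Small.{u} R] {E : Type u} [AddCommGroup E] [Module R E]
    [Module.Injective R E] {K F : Submodule R E} (hF : Maximal K.IsEssentialExt F) :
    ∃ ρ : E →ₗ[R] F, ∀ x : F, ρ x = x := by
  obtain ⟨N, hN⟩ := F.exists_maximal_disjoint
  have hNF := Submodule.disjoint_def.1 hN.prop
  have hker : Function.Injective (N.mkQ ∘ₗ F.subtype) := by
    rw [← LinearMap.ker_eq_bot, LinearMap.ker_eq_bot']
    intro x hx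
    exact Subtype.ext (hNF x ((Submodule.Quotient.mk_eq_zero N).1 hx) x.2)
  obtain ⟨φ, hφ⟩ := Module.Injective.extension_property R E _ _ _ hker F.subtype
  set ψ : E →ₗ[R] E := φ ∘ₗ N.mkQ with hψ
  have hψF : ∀ x ∈ F, ψ x = x := fun x hx => LinearMap.congr_fun hφ ⟨x, hx⟩
  have hψN : ∀ x ∈ N, ψ x = 0 := fun x hx => by
    simp [hψ, (Submodule.Quotient.mk_eq_zero N).2 hx]
  have hmax : ∀ L : Submodule R E, N ≤ L → Disjoint L F → L ≤ N := fun L h h' => hN.le_of_ge h' h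
  have hrange : LinearMap.range ψ ≤ F := by
    refine hF.le_of_ge ⟨?_, ?_⟩ ?_
    · exact fun x hx => ⟨x, hψF x (hF.prop.1 hx)⟩
    · rintro _ ⟨y, rfl⟩ hy
      by_contra! hcon
      have hle : N ⊔ Submodule.span R {y} ≤ N := by
        refine hmax _ le_sup_left (Submodule.disjoint_def.2 fun x hx hxF => ?_)
        obtain ⟨a, ha, b, hb, rfl⟩ := Submodule.mem_sup.1 hx
        obtain ⟨r, rfl⟩ := Submodule.mem_span_singleton.1 hb
        by_contra hne
        have h1 : a + r • y = r • ψ y := by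
          rw [← hψF _ hxF, map_add, hψN a ha, map_smul, zero_add]
        obtain ⟨s, hs, hs0⟩ := hF.prop.2 _ hxF hne
        rw [h1, smul_smul] at hs hs0
        exact hs0 (hcon _ hs)
      exact hy (hψN y (hle (Submodule.mem_sup_right (Submodule.mem_span_singleton_self y))))
    · exact fun x hx => ⟨x, hψF x hx⟩
  exact ⟨ψ.codRestrict F fun x => hrange ⟨x, rfl⟩, fun x => Subtype.ext (hψF x x.2)⟩

lemma Module.Injective.of_retraction [Small.{u} R] {E : Type u} [AddCommGroup E] [Module R E]
    [Module.Injective R E] {F : Submodule R E} {ρ : E →ₗ[R] F} (hρ : ∀ x : F, ρ x = x) :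
    Module.Injective R F where
  out X Y _ _ _ _ f hf g := by
    obtain ⟨h, hh⟩ := Module.Injective.out f hf (F.subtype ∘ₗ g)
    exact ⟨ρ ∘ₗ h, fun x => by simp [hh, hρ]⟩

open IsLocalRing in
/-- The injective hull of the residue field of a local ring. -/
theorem IsLocalRing.exists_injective_hull_residueField (R : Type u) [CommRing R] [IsLocalRing R] :
    ∃ (E : Type u) (_ : AddCommGroup E) (_ : Module R E), Module.Injective R E ∧
      ∃ e₀ : E, e₀ ≠ 0 ∧ (∀ m ∈ maximalIdeal R, m • e₀ = 0) ∧
        ∀ e : E, (∀ m ∈ maximalIdeal R, m • e = 0) → e ∈ Submodule.span R {e₀} := by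
  obtain ⟨⟨J, hJ, f, hf⟩⟩ := CategoryTheory.EnoughInjectives.presentation
    (ModuleCat.of R (ResidueField R))
  have hJ' : Module.Injective R J := Module.injective_module_of_injective_object R J
  have hfinj : Function.Injective f := (ModuleCat.mono_iff_injective f).1 hf
  set e₁ : J := f.hom (1 : ResidueField R) with he₁
  have he₁0 : e₁ ≠ 0 := fun h => one_ne_zero (hfinj (h.trans (map_zero f.hom).symm))
  have he₁m : ∀ m ∈ maximalIdeal R, m • e₁ = 0 := fun m hm => by
    rw [he₁, ← map_smul, Algebra.smul_def, mul_one]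
    have : algebraMap R (ResidueField R) m = 0 := (residue_eq_zero_iff m).2 hm
    rw [this, map_zero]
  obtain ⟨F, hF⟩ := (Submodule.span R {e₁}).exists_maximal_isEssentialExt
  obtain ⟨ρ, hρ⟩ := Submodule.exists_retraction hF
  have hmem : e₁ ∈ F := hF.prop.1 (Submodule.mem_span_singleton_self e₁)
  refine ⟨F, inferInstance, inferInstance, Module.Injective.of_retraction hρ, ⟨e₁, hmem⟩,
    fun h => he₁0 (congrArg Subtype.val h), fun m hm => Subtype.ext (he₁m m hm), fun e he => ?_⟩
  by_cases he0 : e = 0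
  · rw [he0]; exact zero_mem _
  obtain ⟨r, hr, hr0⟩ := hF.prop.2 e e.2 fun h => he0 (Subtype.ext h)
  obtain ⟨s, hs⟩ := Submodule.mem_span_singleton.1 hr
  have hru : IsUnit r := by
    by_contra h
    exact hr0 (congrArg Subtype.val (he r h))
  obtain ⟨u, rfl⟩ := hru
  refine Submodule.mem_span_singleton.2 ⟨↑u⁻¹ * s, Subtype.ext ?_⟩
  rw [mul_smul, Submodule.coe_smul, Submodule.coe_smul, hs, smul_smul, Units.inv_mul, one_smul]

end InjectiveHull

section Monomials

variable {R : Type*} [CommRing R]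

/-- The ideal of those `a` with `a xⁿ ∈ I + (xⁿ⁺¹)` for some `n`; adding it to `I` lowers the
dimension of the quotient. -/
def Ideal.boundary (I : Ideal R) (x : R) : Ideal R where
  carrier := {a | ∃ n : ℕ, a * x ^ n ∈ I ⊔ Ideal.span {x ^ (n + 1)}}
  zero_mem' := ⟨0, by simp⟩
  add_mem' := by
    have key : ∀ {a : R} {n : ℕ}, a * x ^ n ∈ I ⊔ Ideal.span {x ^ (n + 1)} →
        ∀ m, a * x ^ (n + m) ∈ I ⊔ Ideal.span {x ^ (n + m + 1)} := fun {a n} h m => by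
      obtain ⟨i, hi, c, hc, hic⟩ := Submodule.mem_sup.1 h
      obtain ⟨c, rfl⟩ := Ideal.mem_span_singleton'.1 hc
      rw [pow_add x n m, ← mul_assoc, ← hic, add_mul]
      exact Submodule.add_mem_sup (I.mul_mem_right _ hi)
        (Ideal.mem_span_singleton'.2 ⟨c, by ring⟩)
    rintro a b ⟨n, hn⟩ ⟨m, hm⟩
    refine ⟨n + m, ?_⟩
    rw [add_mul]
    refine add_mem (key hn m) ?_
    rw [add_comm n m]
    exact key hm n
  smul_mem' := by
    rintro c a ⟨n, hn⟩
    exact ⟨n, by rw [smul_eq_mul, mul_assoc]; exact Ideal.mul_mem_left _ _ hn⟩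

lemma Ideal.exists_lt_of_boundary_le {I : Ideal R} {x : R} {q : Ideal R} [q.IsPrime]
    (hq : I.boundary x ≤ q) : ∃ q' : Ideal R, q'.IsPrime ∧ I ≤ q' ∧ q' < q := by
  have hdisj : Disjoint (I : Set R) (q.primeCompl ⊔ Submonoid.powers x : Submonoid R) := by
    rw [Set.disjoint_left]
    intro a ha ha'
    obtain ⟨u, hu, w, ⟨n, rfl⟩, rfl⟩ := Submonoid.mem_sup.1 ha'
    exact hu (hq ⟨n, Ideal.mem_sup_left ha⟩)
  obtain ⟨q', hq', hIq', hd⟩ := Ideal.exists_le_prime_disjoint I _ hdisj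
  have hxq : x ∈ q := hq ⟨0, Ideal.mem_sup_right (Ideal.mem_span_singleton'.2 ⟨1, by ring⟩)⟩
  have hxq' : x ∉ q' := fun h => Set.disjoint_left.1 hd h
    ((le_sup_right : Submonoid.powers x ≤ _) (Submonoid.mem_powers x))
  refine ⟨q', hq', hIq', lt_of_le_of_ne (fun a ha => ?_) fun h => hxq' (h ▸ hxq)⟩
  by_contra haq
  exact Set.disjoint_left.1 hd ha ((le_sup_left : q.primeCompl ≤ _) haq)

/-- If all chains of primes containing `I` have fewer than `d` steps, then some power of
`x₁ ⋯ x_d` lies in `I` plus the ideal of the next powers of the `xᵢ`. -/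
lemma Ideal.exists_prod_pow_mem : ∀ {d : ℕ} (x : Fin d → R) (I : Ideal R),
    (∀ l : LTSeries (PrimeSpectrum R), I ≤ l.head.asIdeal → l.length < d) →
    ∃ t : ℕ, (∏ i, x i) ^ t ∈ I ⊔ Ideal.span (Set.range fun i => x i ^ (t + 1))
  | 0, x, I, h => by
    refine ⟨0, Ideal.mem_sup_left ?_⟩
    suffices I = ⊤ by simp [this]
    by_contra hI
    obtain ⟨q, hq, hIq⟩ := Ideal.exists_le_maximal I hI
    exact absurd (h (RelSeries.singleton _ ⟨q, hq.isPrime⟩) hIq) (Nat.not_lt_zero _)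
  | d + 1, x, I, h => by
    obtain ⟨t, ht⟩ := exists_prod_pow_mem (fun i : Fin d => x i.succ) (I.boundary (x 0)) (by
      intro l hl
      obtain ⟨q, hq, hIq, hlt⟩ := Ideal.exists_lt_of_boundary_le hl
      have := h (l.cons ⟨q, hq⟩ hlt) (by simpa using hIq)
      simpa using this)
    obtain ⟨a, ⟨n, hn⟩, b, hb, hab⟩ := Submodule.mem_sup.1 ht
    refine ⟨t + n, ?_⟩
    set y := ∏ i : Fin d, x i.succ with hy
    have hb' : b * y ^ n ∈ Ideal.span (Set.range fun i : Fin d => x i.succ ^ (t + n + 1)) := by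
      refine Submodule.span_induction (p := fun b _ => b * y ^ n ∈ _) ?_ (by simp)
        (fun b c _ _ hb hc => by rw [add_mul]; exact add_mem hb hc)
        (fun r b _ hb => by rw [smul_eq_mul, mul_assoc]; exact Ideal.mul_mem_left _ _ hb) hb
      rintro _ ⟨i, rfl⟩
      refine Ideal.mem_of_dvd _ ?_ (Ideal.subset_span ⟨i, rfl⟩)
      have : x i.succ ∣ y := Finset.dvd_prod_of_mem (fun i : Fin d => x i.succ) (Finset.mem_univ i)
      simp only [show t + n + 1 = (t + 1) + n by ring, pow_add _ (t + 1) n]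
      exact mul_dvd_mul_left _ (pow_dvd_pow_of_dvd this n)
    obtain ⟨i, hi, c, hc, hic⟩ := Submodule.mem_sup.1 hn
    obtain ⟨c, rfl⟩ := Ideal.mem_span_singleton'.1 hc
    rw [Fin.prod_univ_succ, ← hy, Ideal.span_range_fin_succ]
    have heq : (x 0 * y) ^ (t + n) = i * (x 0 ^ t * y ^ n) +
        (c * y ^ n * x 0 ^ (t + n + 1) + x 0 ^ (t + n) * (b * y ^ n)) := by
      have : (x 0 * y) ^ (t + n) = x 0 ^ (t + n) * y ^ n * y ^ t := by ring
      rw [this, ← hab]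
      linear_combination -(x 0 ^ t * y ^ n) * hic
    rw [heq]
    exact Submodule.add_mem_sup (I.mul_mem_right _ hi) (Submodule.add_mem_sup
      (Ideal.mem_span_singleton'.2 ⟨_, rfl⟩) (Ideal.mul_mem_left _ _ hb'))

lemma exists_prod_pow_mem_of_ne_zero [IsDomain R] {d : ℕ} (hd : ringKrullDim R ≤ d)
    (x : Fin d → R) {s : R} (hs : s ≠ 0) :
    ∃ t : ℕ, (∏ i, x i) ^ t ∈ Ideal.span {s} ⊔ Ideal.span (Set.range fun i => x i ^ (t + 1)) := by
  refine Ideal.exists_prod_pow_mem x _ fun l hl => ?_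
  have hlt : (⊥ : PrimeSpectrum R) < l.head := by
    rw [bot_lt_iff_ne_bot]
    intro h
    rw [h] at hl
    exact hs (by simpa using hl (Ideal.mem_span_singleton_self s))
  have h1 := (Order.LTSeries.length_le_krullDim (l.cons ⊥ hlt)).trans hd
  have h2 : (l.cons ⊥ hlt).length ≤ d := by exact_mod_cast h1
  simpa using h2

end Monomials

section CoherentSequences

variable {R : Type*} [CommRing R]

/-- The `R`-linear maps from `R[1/x] ⧸ R` to `D`, described by the images `f k` of the `x⁻ᵏ`. -/
def tateSubmodule (x : R) (D : Type*) [AddCommGroup D] [Module R D] : Submodule R (ℕ → D) where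
  carrier := {f | f 0 = 0 ∧ ∀ k, x • f (k + 1) = f k}
  zero_mem' := by simp
  add_mem' := by
    rintro f g ⟨hf, hf'⟩ ⟨hg, hg'⟩
    exact ⟨by simp [hf, hg], fun k => by simp [hf', hg', smul_add]⟩
  smul_mem' := by
    rintro r f ⟨hf, hf'⟩
    exact ⟨by simp [hf], fun k => by simp [← hf' k, smul_comm x r]⟩

/-- The `R`-linear maps from the top local cohomology with support in `(x₁, …, x_d)` to `E`,
described by the images `w n` of the classes of `(x₁ ⋯ x_d)⁻ⁿ`. -/
def coherentSubmodule {d : ℕ} (x : Fin d → R) (E : Type*) [AddCommGroup E] [Module R E] :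
    Submodule R (ℕ → E) where
  carrier := {w | (∀ n i, x i ^ n • w n = 0) ∧ ∀ n, (∏ i, x i) • w (n + 1) = w n}
  zero_mem' := by simp
  add_mem' := by
    rintro f g ⟨hf, hf'⟩ ⟨hg, hg'⟩
    exact ⟨fun n i => by simp [hf, hg], fun k => by simp [hf', hg', smul_add]⟩
  smul_mem' := by
    rintro r f ⟨hf, hf'⟩
    exact ⟨fun n i => by simp [smul_comm _ r, hf n i],
      fun k => by simp [← hf' k, smul_comm _ r]⟩

variable {D : Type*} [AddCommGroup D] [Module R D]

lemma tateSubmodule.pow_smul_eq_zero {x : R} {f : ℕ → D} (hf : f ∈ tateSubmodule x D) :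
    ∀ k, x ^ k • f k = 0
  | 0 => by simp [hf.1]
  | k + 1 => by rw [pow_succ, mul_smul, hf.2 k, pow_smul_eq_zero hf k]

lemma coherentSubmodule.prod_pow_smul {d : ℕ} {x : Fin d → R} {w : ℕ → D}
    (hw : w ∈ coherentSubmodule x D) (n : ℕ) : ∀ k, (∏ i, x i) ^ k • w (n + k) = w n
  | 0 => by simp
  | k + 1 => by rw [pow_succ, mul_smul, ← add_assoc, hw.2, prod_pow_smul hw n k]

open IsLocalRing in
/-- A linear map from a finite free module over a complete local ring to a Tate module is
surjective as soon as it is so modulo `x`. -/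
lemma tateSubmodule.surjective_of_forall_exists [IsNoetherianRing R] [IsLocalRing R]
    [IsAdicComplete (maximalIdeal R) R] {x : R} (hx : x ∈ maximalIdeal R) {n : ℕ}
    (F : (Fin n → R) →ₗ[R] tateSubmodule x D)
    (hF : ∀ f : tateSubmodule x D, ∃ c f', f = F c + x • f') : Function.Surjective F := by
  intro f
  choose c next hnext using hF
  let s : ℕ → tateSubmodule x D := fun t => next^[t] f
  let C : ℕ → Fin n → R := fun T => ∑ t ∈ Finset.range T, x ^ t • c (s t)
  have hC : ∀ T, f = F (C T) + x ^ T • s T := by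
    intro T
    induction T with
    | zero => simp [C, s]
    | succ T ih =>
      have hs : s (T + 1) = next (s T) := Function.iterate_succ_apply' next T f
      have hCs : C (T + 1) = C T + x ^ T • c (s T) := Finset.sum_range_succ _ T
      rw [hCs, map_add, map_smul, hs, add_assoc, pow_succ, mul_smul, ← smul_add, ← hnext, ← ih]
  have hlim : ∀ i, ∃ L : R, ∀ T, C T i - L ∈ maximalIdeal R ^ T := by
    intro i
    obtain ⟨L, hL⟩ := IsPrecomplete.prec (I := maximalIdeal R) (M := R) inferInstance
      (f := fun T => C T i) (by
        intro a b hab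
        rw [SModEq.sub_mem, smul_eq_mul, Ideal.mul_top]
        have : C b = C a + ∑ t ∈ Finset.Ico a b, x ^ t • c (s t) :=
          (Finset.sum_range_add_sum_Ico _ hab).symm
        rw [this, Pi.add_apply, sub_add_cancel_left, Finset.sum_apply]
        refine neg_mem (sum_mem fun t ht => Ideal.mul_mem_right _ _ ?_)
        exact Ideal.pow_le_pow_right (Finset.mem_Ico.1 ht).1 (Ideal.pow_mem_pow hx t))
    refine ⟨L, fun T => ?_⟩
    have := hL T
    rwa [SModEq.sub_mem, smul_eq_mul, Ideal.mul_top] at this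
  choose L hL using hlim
  refine ⟨L, Subtype.ext (funext fun k => ?_)⟩
  let Φ : (Fin n → R) →ₗ[R] D := LinearMap.proj k ∘ₗ (tateSubmodule x D).subtype ∘ₗ F
  have hΦ : ∀ T, k ≤ T → Φ (C T - L) = (f : ℕ → D) k - (F L : ℕ → D) k := by
    intro T hT
    have h1 : x ^ T • (s T : ℕ → D) k = 0 := by
      obtain ⟨j, rfl⟩ := Nat.exists_eq_add_of_le' hT
      rw [pow_add, mul_smul, tateSubmodule.pow_smul_eq_zero (s _).2, smul_zero]
    have h2 : (f : ℕ → D) k = (F (C T) : ℕ → D) k + x ^ T • (s T : ℕ → D) k :=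
      congrArg (fun g : tateSubmodule x D => (g : ℕ → D) k) (hC T)
    rw [h2, h1, add_zero, map_sub]
    rfl
  have hmem : ∀ T, Φ.rangeRestrict (C (k + T) - L) ∈
      (maximalIdeal R ^ T • ⊤ : Submodule R (LinearMap.range Φ)) := by
    intro T
    rw [LinearMap.pi_apply_eq_sum_univ Φ.rangeRestrict]
    refine sum_mem fun i _ => Submodule.smul_mem_smul ?_ trivial
    exact Ideal.pow_le_pow_right (Nat.le_add_left T k) (hL i _)
  have hconst : ∀ T, Φ.rangeRestrict (C (k + T) - L) = Φ.rangeRestrict (C k - L) := fun T =>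
    Subtype.ext ((hΦ _ (Nat.le_add_right k T)).trans (hΦ _ le_rfl).symm)
  have hzero : Φ.rangeRestrict (C k - L) = 0 := by
    rw [← Submodule.mem_bot R, ← Ideal.iInf_pow_smul_eq_bot_of_isLocalRing (maximalIdeal R)
      (Ideal.IsPrime.ne_top inferInstance), Submodule.mem_iInf]
    exact fun T => hconst T ▸ hmem T
  have := hΦ k le_rfl
  rw [show Φ (C k - L) = 0 from congrArg Subtype.val hzero] at this
  exact (sub_eq_zero.1 this.symm).symm

open IsLocalRing in
lemma tateSubmodule.finite [IsNoetherianRing R] [IsLocalRing R]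
    [IsAdicComplete (maximalIdeal R) R] {x : R} (hx : x ∈ maximalIdeal R)
    [Module.Finite R (Submodule.torsionBy R D x)] : Module.Finite R (tateSubmodule x D) := by
  let ev : tateSubmodule x D →ₗ[R] Submodule.torsionBy R D x :=
    (LinearMap.proj 1 ∘ₗ (tateSubmodule x D).subtype).codRestrict _ fun f => by
      simp [f.2.2 0, f.2.1]
  obtain ⟨n, g, hg⟩ := Module.Finite.exists_fin' R (LinearMap.range ev)
  obtain ⟨F, hF⟩ := Module.projective_lifting_property ev.rangeRestrict g
    ev.surjective_rangeRestrict
  refine Module.Finite.of_surjective F (tateSubmodule.surjective_of_forall_exists hx F fun f => ?_)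
  obtain ⟨c, hc⟩ := hg (ev.rangeRestrict f)
  have h1 : (f - F c : ℕ → D) 1 = 0 := by
    rw [← hF] at hc
    have := congrArg (fun a : LinearMap.range ev => ((a : Submodule.torsionBy R D x) : D)) hc
    exact sub_eq_zero.2 this.symm
  have hfc := (f - F c).2
  refine ⟨c, ⟨fun k => (f - F c : ℕ → D) (k + 1), h1, fun k => hfc.2 (k + 1)⟩, ?_⟩
  rw [← sub_eq_iff_eq_add']
  exact Subtype.ext (funext fun k => (hfc.2 k).symm)

open IsLocalRing in
lemma coherentSubmodule.finite [IsNoetherianRing R] [IsLocalRing R]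
    [IsAdicComplete (maximalIdeal R) R] : ∀ {d : ℕ} (x : Fin d → R),
    (∀ i, x i ∈ maximalIdeal R) → ∀ (E : Type*) [AddCommGroup E] [Module R E],
    Module.Finite R (⨅ i, Submodule.torsionBy R E (x i) : Submodule R E) →
    Module.Finite R (coherentSubmodule x E)
  | 0, x, _, E, _, _, h => by
    let φ : coherentSubmodule x E →ₗ[R] (⨅ i, Submodule.torsionBy R E (x i) : Submodule R E) :=
      (LinearMap.proj 0 ∘ₗ (coherentSubmodule x E).subtype).codRestrict _ (by simp)
    refine Module.Finite.of_injective φ fun w w' hww => Subtype.ext (funext fun n => ?_)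
    have h0 : (w : ℕ → E) 0 = (w' : ℕ → E) 0 := congrArg Subtype.val hww
    have h1 := prod_pow_smul w.2 0 n
    have h2 := prod_pow_smul w'.2 0 n
    simp only [Finset.univ_eq_empty, Finset.prod_empty, one_pow, one_smul, zero_add] at h1 h2
    rw [h1, h2, h0]
  | d + 1, x, hx, E, _, _, h => by
    let E' := Submodule.torsionBy R E (x 0)
    let z : Fin d → R := fun i => x i.succ
    have hE' : Module.Finite R (⨅ i, Submodule.torsionBy R E' (z i) : Submodule R E') := by
      refine Module.Finite.of_injective
        ((E'.subtype ∘ₗ (⨅ i, Submodule.torsionBy R E' (z i)).subtype).codRestrict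
          (⨅ i, Submodule.torsionBy R E (x i)) fun e => ?_)
        fun e e' hee => Subtype.ext (Subtype.ext (by simpa using congrArg Subtype.val hee))
      have he := e.2
      simp only [Submodule.mem_iInf, Submodule.mem_torsionBy_iff] at he ⊢
      intro i
      cases i using Fin.cases with
      | zero => exact e.1.2
      | succ i => exact congrArg Subtype.val (he i)
    have hfin := coherentSubmodule.finite z (fun i => hx i.succ) E' hE'
    have htors : Module.Finite R (Submodule.torsionBy R (coherentSubmodule z E) (x 0)) := by
      let φ : Submodule.torsionBy R (coherentSubmodule z E) (x 0) →ₗ[R] coherentSubmodule z E' :=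
        { toFun := fun w => ⟨fun n => ⟨(w : coherentSubmodule z E).1 n,
            congrFun (congrArg Subtype.val w.2) n⟩,
            fun n i => Subtype.ext (w.1.2.1 n i), fun n => Subtype.ext (w.1.2.2 n)⟩
          map_add' := fun _ _ => rfl
          map_smul' := fun _ _ => rfl }
      refine Module.Finite.of_injective φ fun w w' hww => ?_
      refine Subtype.ext (Subtype.ext (funext fun n => ?_))
      exact congrArg (fun v : coherentSubmodule z E' => (v.1 n : E)) hww
    have htate := tateSubmodule.finite (D := coherentSubmodule z E) (hx 0)
    have hnoeth := isNoetherian_of_isNoetherianRing_of_finite R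
      (tateSubmodule (x 0) (coherentSubmodule z E))
    set y := ∏ i, z i with hy
    have hprod : ∏ i, x i = x 0 * y := Fin.prod_univ_succ x
    have hdvd : ∀ i, z i ∣ y := fun i => Finset.dvd_prod_of_mem z (Finset.mem_univ i)
    have hstep : ∀ (w : coherentSubmodule x E) (n : ℕ), w.1 n = (x 0 * y) • w.1 (n + 1) :=
      fun w n => by rw [← hprod, w.2.2]
    let φ : coherentSubmodule x E →ₗ[R] tateSubmodule (x 0) (coherentSubmodule z E) :=
      { toFun := fun w => ⟨fun k => ⟨fun n => (x 0 ^ n * y ^ k) • w.1 (n + k), by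
            intro n i
            obtain ⟨a, ha⟩ := pow_dvd_pow_of_dvd (hdvd i) k
            have := w.2.1 (n + k) i.succ
            rw [smul_smul, ha, show z i ^ n * (x 0 ^ n * (z i ^ k * a)) =
              (x 0 ^ n * a) * z i ^ (n + k) by ring, mul_smul, this, smul_zero], by
            intro n
            change y • (x 0 ^ (n + 1) * y ^ k) • w.1 (n + 1 + k) = (x 0 ^ n * y ^ k) • w.1 (n + k)
            rw [smul_smul, hstep w (n + k), smul_smul, add_right_comm]
            congr 1
            ring⟩,
          Subtype.ext (funext fun n => by
            have := w.2.1 n 0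
            simpa using this), fun k => Subtype.ext (funext fun n => by
            change x 0 • (x 0 ^ n * y ^ (k + 1)) • w.1 (n + (k + 1)) =
              (x 0 ^ n * y ^ k) • w.1 (n + k)
            rw [smul_smul, hstep w (n + k), smul_smul, add_assoc]
            congr 1
            ring)⟩
        map_add' := fun w w' => Subtype.ext (funext fun k => Subtype.ext (funext fun n =>
          smul_add _ _ _))
        map_smul' := fun r w => Subtype.ext (funext fun k => Subtype.ext (funext fun n =>
          smul_comm _ _ _)) }
    refine Module.Finite.of_injective φ fun w w' hww => Subtype.ext (funext fun n => ?_)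
    have hn : (x 0 ^ n * y ^ n) • w.1 (n + n) = (x 0 ^ n * y ^ n) • w'.1 (n + n) :=
      congrArg (fun v : tateSubmodule (x 0) (coherentSubmodule z E) => (v.1 n).1 n) hww
    rwa [← mul_pow, ← hprod, prod_pow_smul w.2, prod_pow_smul w'.2] at hn

open IsLocalRing in
lemma IsLocalRing.finite_torsionBySet_pow [IsNoetherianRing R] [IsLocalRing R] {e₀ : D}
    (he₀ : ∀ e : D, (∀ m ∈ maximalIdeal R, m • e = 0) → e ∈ Submodule.span R {e₀}) :
    ∀ n : ℕ, Module.Finite R (Submodule.torsionBySet R D (maximalIdeal R ^ n : Ideal R))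
  | 0 => by
    have : Submodule.torsionBySet R D (maximalIdeal R ^ 0 : Ideal R) = ⊥ := by simp
    rw [this]
    infer_instance
  | n + 1 => by
    have ih := finite_torsionBySet_pow he₀ n
    obtain ⟨k, g, hg⟩ := (Submodule.fg_iff_exists_fin_generating_family (R := R)
      (N := maximalIdeal R)).1 (IsNoetherian.noetherian _)
    have hgm : ∀ i, g i ∈ maximalIdeal R := fun i => hg ▸ Submodule.subset_span ⟨i, rfl⟩
    let T := Submodule.torsionBySet R D (maximalIdeal R ^ (n + 1) : Ideal R)
    let φ : T →ₗ[R] (Fin k → Submodule.torsionBySet R D (maximalIdeal R ^ n : Ideal R)) :=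
      LinearMap.pi fun i => (g i • T.subtype).codRestrict _ fun e => by
        rw [Submodule.mem_torsionBySet_iff]
        rintro ⟨a, ha⟩
        have h := (Submodule.mem_torsionBySet_iff _ _).1 e.2 ⟨a * g i, by
          rw [pow_succ]; exact Ideal.mul_mem_mul ha (hgm i)⟩
        simpa [mul_smul] using h
    have hker : IsNoetherian R (LinearMap.ker φ) := by
      refine isNoetherian_of_injective ((T.subtype ∘ₗ (LinearMap.ker φ).subtype).codRestrict
        (Submodule.span R {e₀}) fun e => he₀ _ fun m hm => ?_)
        fun e e' hee => Subtype.ext (Subtype.ext (by simpa using congrArg Subtype.val hee))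
      rw [← hg] at hm
      refine Submodule.span_induction (p := fun m _ => m • (e.1.1 : D) = 0) ?_ (zero_smul _ _)
        (fun a b _ _ ha hb => by rw [add_smul, ha, hb, add_zero])
        (fun r a _ ha => by rw [smul_assoc, ha, smul_zero]) hm
      rintro _ ⟨i, rfl⟩
      exact congrArg Subtype.val (congrFun e.2 i)
    have hT : IsNoetherian R T := isNoetherian_of_range_eq_ker (LinearMap.ker φ).subtype φ
      (by simp)
    exact inferInstanceAs (Module.Finite R T)

end CoherentSequences

section FiniteQuotient

lemma Module.Injective.exists_comp_eq_of_ker_le {R : Type*} [CommRing R] [Small.{v} R]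
    {M N : Type v} {E : Type v} [AddCommGroup M] [Module R M] [AddCommGroup N] [Module R N]
    [AddCommGroup E] [Module R E] [Module.Injective R E] (f : M →ₗ[R] N) (g : M →ₗ[R] E)
    (hfg : LinearMap.ker f ≤ LinearMap.ker g) : ∃ h : N →ₗ[R] E, ∀ m, h (f m) = g m := by
  obtain ⟨h, hh⟩ := Module.Injective.extension_property R E _ _
    ((LinearMap.ker f).liftQ f le_rfl)
    (LinearMap.ker_eq_bot.1 (Submodule.ker_liftQ_eq_bot _ _ _ le_rfl))
    ((LinearMap.ker f).liftQ g hfg)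
  exact ⟨h, fun m => by simpa using LinearMap.congr_fun hh (Submodule.Quotient.mk m)⟩

open IsLocalRing

variable {R B : Type u} [CommRing R] [CommRing B] [Algebra R B] {d : ℕ}

lemma exists_linearMap_apply_one_ne_zero [IsLocalRing R] {E : Type u} [AddCommGroup E]
    [Module R E] [Module.Injective R E] {e₀ : E} (he₀ : e₀ ≠ 0)
    (he₀m : ∀ m ∈ maximalIdeal R, m • e₀ = 0) {I : Ideal B} (hI : I ≠ ⊤) :
    ∃ f : B →ₗ[R] E, (∀ b ∈ I, f b = 0) ∧ f 1 ≠ 0 := by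
  obtain ⟨h, hh⟩ := Module.Injective.exists_comp_eq_of_ker_le
    (Algebra.linearMap R (B ⧸ I)) (LinearMap.toSpanSingleton R E e₀) fun r hr => by
      refine he₀m r fun hu => hI ?_
      have : algebraMap R B r ∈ I := Ideal.Quotient.eq_zero_iff_mem.1 hr
      exact Ideal.eq_top_of_isUnit_mem _ this (hu.map _)
  refine ⟨h ∘ₗ (Ideal.Quotient.mkₐ R I).toLinearMap, fun b hb => ?_, ?_⟩
  · simp [Ideal.Quotient.eq_zero_iff_mem.2 hb]
  · have := hh 1
    simp only [map_one, Algebra.linearMap_apply, LinearMap.toSpanSingleton_apply, one_smul] at this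
    simpa [this] using he₀

lemma exists_linearMap_mul_left_eq {E : Type u} [AddCommGroup E] [Module R E]
    [Module.Injective R E] {I I' : Ideal B} {y : B} (hy : ∀ b, y * b ∈ I' → b ∈ I)
    (f : B →ₗ[R] E) (hf : ∀ b ∈ I, f b = 0) :
    ∃ g : B →ₗ[R] E, (∀ b ∈ I', g b = 0) ∧ ∀ b, g (y * b) = f b := by
  obtain ⟨h, hh⟩ := Module.Injective.exists_comp_eq_of_ker_le
    ((Ideal.Quotient.mkₐ R I').toLinearMap ∘ₗ LinearMap.mulLeft R y) f fun b hb =>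
      hf b (hy b (Ideal.Quotient.eq_zero_iff_mem.1 hb))
  refine ⟨h ∘ₗ (Ideal.Quotient.mkₐ R I').toLinearMap, fun b hb => ?_, hh⟩
  simp [Ideal.Quotient.eq_zero_iff_mem.2 hb]

lemma exists_linearMap_seq [IsLocalRing R] {E : Type u} [AddCommGroup E]
    [Module R E] [Module.Injective R E] {e₀ : E} (he₀ : e₀ ≠ 0)
    (he₀m : ∀ m ∈ maximalIdeal R, m • e₀ = 0) {z : Fin d → B} (hz : IsRegSeq z) :
    ∃ f : ℕ → B →ₗ[R] E, (∀ n, ∀ b ∈ Ideal.span (Set.range fun i => z i ^ (n + 1)), f n b = 0) ∧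
      (∀ n b, f (n + 1) ((∏ i, z i) * b) = f n b) ∧ f 0 1 ≠ 0 := by
  have hz' : IsWeaklyRegSeqMod d z ⊥ := IsWeaklyRegSeqMod.of_forall (by simpa using hz.1)
  have hstep : ∀ (n : ℕ) (f : B →ₗ[R] E), ∃ g : B →ₗ[R] E,
      (∀ b ∈ Ideal.span (Set.range fun i => z i ^ (n + 1)), f b = 0) →
        (∀ b ∈ Ideal.span (Set.range fun i => z i ^ (n + 2)), g b = 0) ∧
          ∀ b, g ((∏ i, z i) * b) = f b := by
    intro n f
    by_cases hf : ∀ b ∈ Ideal.span (Set.range fun i => z i ^ (n + 1)), f b = 0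
    · obtain ⟨g, hg⟩ := exists_linearMap_mul_left_eq
        (fun b hb => by simpa using hz'.mem_of_prod_mul_mem (n + 1) b (by simpa using hb)) f hf
      exact ⟨g, fun _ => hg⟩
    · exact ⟨0, fun h => absurd h hf⟩
  choose next hnext using hstep
  obtain ⟨f₀, hf₀, hf₀1⟩ := exists_linearMap_apply_one_ne_zero he₀ he₀m hz.2
  let f : ℕ → B →ₗ[R] E := fun n => Nat.rec f₀ next n
  have hf : ∀ n, ∀ b ∈ Ideal.span (Set.range fun i => z i ^ (n + 1)), f n b = 0 := by
    intro n
    induction n with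
    | zero =>
      intro b hb
      exact hf₀ b (by simpa using hb)
    | succ n ih => exact (hnext n (f n) ih).1
  exact ⟨f, hf, fun n => (hnext n (f n) (hf n)).2, hf₀1⟩

lemma IsSOP.finite_iInf_torsionBy [IsNoetherianRing R] [IsLocalRing R] {x : Fin d → R}
    (hx : IsSOP R x) {E : Type*} [AddCommGroup E] [Module R E] {e₀ : E}
    (he₀ : ∀ e : E, (∀ m ∈ maximalIdeal R, m • e = 0) → e ∈ Submodule.span R {e₀}) :
    Module.Finite R (⨅ i, Submodule.torsionBy R E (x i) : Submodule R E) := by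
  obtain ⟨c, hc⟩ := Ideal.exists_pow_le_of_le_radical_of_fg hx.2.2.ge
    (IsNoetherian.noetherian (maximalIdeal R))
  have := IsLocalRing.finite_torsionBySet_pow he₀ c
  have := isNoetherian_of_isNoetherianRing_of_finite R
    (Submodule.torsionBySet R E (maximalIdeal R ^ c : Ideal R))
  have hle : (⨅ i, Submodule.torsionBy R E (x i)) ≤
      Submodule.torsionBySet R E (maximalIdeal R ^ c : Ideal R) := by
    intro e he
    simp only [Submodule.mem_iInf, Submodule.mem_torsionBy_iff] at he
    rw [Submodule.mem_torsionBySet_iff]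
    rintro ⟨a, ha⟩
    have hspan : Ideal.span (Set.range x) ≤ LinearMap.ker (LinearMap.toSpanSingleton R E e) := by
      rw [Ideal.span_le]
      rintro _ ⟨i, rfl⟩
      exact he i
    exact hspan (hc ha)
  exact Module.Finite.of_injective (Submodule.inclusion hle) (Submodule.inclusion_injective hle)

/-- An algebra over a complete local domain which is Cohen-Macaulay with respect to a system of
parameters has an `R`-linear map to a finite module such that the image of `1` has trivial
annihilator. -/
theorem IsCMwrt.exists_linearMap_finite [IsDomain R] [IsNoetherianRing R] [IsLocalRing R]
    [IsAdicComplete (maximalIdeal R) R] {x : Fin d → R} (hx : IsSOP R x)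
    (hCM : IsCMwrt (algebraMap R B) x) :
    ∃ (W : Type u) (_ : AddCommGroup W) (_ : Module R W) (_ : Module.Finite R W)
      (Φ : B →ₗ[R] W), ∀ s : R, Φ (algebraMap R B s) = 0 → s = 0 := by
  obtain ⟨E, _, _, _, e₀, he₀, he₀m, hspan⟩ := exists_injective_hull_residueField R
  obtain ⟨f, hf, hfy, hf1⟩ := exists_linearMap_seq (R := R) he₀ he₀m hCM
  have hfy' : ∀ n b, (∏ i, x i) • f (n + 1) b = f n b := fun n b => by
    rw [← hfy n b, ← map_smul, Algebra.smul_def, map_prod]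
  have hfx : ∀ n i b, x i ^ (n + 1) • f n b = 0 := fun n i b => by
    rw [← map_smul, Algebra.smul_def, map_pow]
    exact hf n _ (Ideal.mul_mem_right _ _ (Ideal.subset_span ⟨i, rfl⟩))
  have hfin := coherentSubmodule.finite x hx.2.1 E (hx.finite_iInf_torsionBy hspan)
  let Φ : B →ₗ[R] coherentSubmodule x E :=
    (LinearMap.pi fun n => (∏ i, x i) • f n).codRestrict _ fun b => by
      refine ⟨fun n i => ?_, fun n => congrArg _ (hfy' n b)⟩
      obtain ⟨a, ha⟩ := Finset.dvd_prod_of_mem x (Finset.mem_univ i)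
      change x i ^ n • (∏ i, x i) • f n b = 0
      rw [ha, smul_smul, ← mul_assoc, ← pow_succ, mul_comm, mul_smul, hfx, smul_zero]
  refine ⟨coherentSubmodule x E, _, _, hfin, Φ, fun s hs => ?_⟩
  by_contra hs0
  obtain ⟨t, ht⟩ := exists_prod_pow_mem_of_ne_zero hx.1.ge x hs0
  have hst : f t (algebraMap R B s) = 0 := by
    rw [← hfy']
    exact congrArg (fun w : coherentSubmodule x E => (w : ℕ → E) (t + 1)) hs
  have hle : Ideal.span {s} ⊔ Ideal.span (Set.range fun i => x i ^ (t + 1)) ≤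
      LinearMap.ker (f t ∘ₗ Algebra.linearMap R B) := by
    refine sup_le ((Ideal.span_singleton_le_iff_mem _).2 hst) (Ideal.span_le.2 ?_)
    rintro _ ⟨i, rfl⟩
    refine hf t _ (Ideal.subset_span ⟨i, ?_⟩)
    simp
  have hpow : ∀ t, f t (algebraMap R B ((∏ i, x i) ^ t)) = f 0 1 := by
    intro t
    induction t with
    | zero => simp
    | succ t ih => rw [pow_succ', map_mul, map_prod, hfy, ih]
  exact hf1 ((hpow t).symm.trans (hle ht))

end FiniteQuotient

section LinearGrowth

open IsLocalRing

lemma Ideal.sup_pow_le {B : Type*} [CommRing B] (I K : Ideal B) (n : ℕ) :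
    (I ⊔ K) ^ n ≤ I ^ n ⊔ K := by
  induction n with
  | zero => simp
  | succ n ih =>
    rw [pow_succ, pow_succ]
    refine (Ideal.mul_mono_left ih).trans ?_
    rw [Ideal.sup_mul, Ideal.mul_sup]
    exact sup_le (sup_le_sup_left Ideal.mul_le_right _) (le_sup_of_le_right Ideal.mul_le_left)

lemma Ideal.span_range_le_pow_sup {B : Type*} [CommRing B] {p : ℕ} (hp : 1 < p) {π : ℕ → B}
    (hπ : ∀ e, π (e + 1) ^ p = π e) {I K : Ideal B} (h : Ideal.span (Set.range π) ≤ I ⊔ K)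
    (n : ℕ) : Ideal.span (Set.range π) ≤ I ^ n ⊔ K := by
  have hroot : ∀ e k, π (e + k) ^ p ^ k = π e := by
    intro e k
    induction k with
    | zero => simp
    | succ k ih => rw [pow_succ', pow_mul, ← add_assoc, hπ, ih]
  rw [Ideal.span_le]
  rintro _ ⟨e, rfl⟩
  rw [← hroot e n]
  refine (sup_le_sup_right (Ideal.pow_le_pow_right (Nat.lt_pow_self hp).le) K)
    (Ideal.sup_pow_le I K _ (Ideal.pow_mem_pow (h (Ideal.subset_span ⟨_, rfl⟩)) _))

variable {R : Type*} [CommRing R] {Q : Type*} [AddCommGroup Q] [Module R Q]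

/-- Multiplication by a nonzerodivisor shifts an adic filtration by a bounded amount. -/
lemma Ideal.exists_forall_pow_smul_mem_imp [IsNoetherianRing R] [Module.Finite R Q] (I : Ideal R)
    {r : R} (hr : ∀ w : Q, r • w = 0 → w = 0) :
    ∃ c : ℕ, ∀ (a L : ℕ) (w : Q), r ^ a • w ∈ (I ^ L • ⊤ : Submodule R Q) →
      w ∈ (I ^ (L - c * a) • ⊤ : Submodule R Q) := by
  let f : Q →ₗ[R] Q := LinearMap.lsmul R Q r
  have hf : Function.Injective f := (injective_iff_map_eq_zero f).2 hr
  obtain ⟨c, hc⟩ := Ideal.exists_pow_inf_eq_pow_smul I (LinearMap.range f)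
  have hone : ∀ (L : ℕ) (w : Q), r • w ∈ (I ^ L • ⊤ : Submodule R Q) →
      w ∈ (I ^ (L - c) • ⊤ : Submodule R Q) := by
    intro L w hw
    rcases le_total L c with hL | hL
    · simp [Nat.sub_eq_zero_of_le hL]
    have h1 : f w ∈ (I ^ L • ⊤ ⊓ LinearMap.range f : Submodule R Q) := ⟨hw, w, rfl⟩
    rw [hc L hL] at h1
    have h2 : f w ∈ Submodule.map f (I ^ (L - c) • ⊤ : Submodule R Q) := by
      rw [Submodule.map_smul'', Submodule.map_top]
      exact Submodule.smul_mono le_rfl inf_le_right h1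
    obtain ⟨w', hw', hww⟩ := h2
    exact hf hww ▸ hw'
  refine ⟨c, fun a => ?_⟩
  induction a with
  | zero => simp
  | succ a ih =>
    intro L w hw
    rw [pow_succ', mul_smul] at hw
    have := ih _ w (hone L _ hw)
    rwa [Nat.sub_sub, add_comm, ← Nat.mul_succ] at this

/-- If the powers of `r` move a finite module into the powers of the maximal ideal at an
arbitrarily fast linear rate, then `r` is nilpotent on it. -/
lemma IsLocalRing.exists_pow_smul_eq_zero [IsNoetherianRing R] [IsLocalRing R]
    [Module.Finite R Q] {r : R}
    (hr : ∀ n : ℕ, ∃ N : ℕ, ∀ (L : ℕ) (w : Q),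
      r ^ (N + L) • w ∈ (maximalIdeal R ^ (n * L) • ⊤ : Submodule R Q)) :
    ∃ j : ℕ, ∀ w : Q, r ^ j • w = 0 := by
  obtain ⟨j, hj⟩ := monotone_stabilizes_iff_noetherian.2 (inferInstance : IsNoetherian R Q)
    ⟨fun j => Submodule.torsionBy R Q (r ^ j), fun a b hab w hw =>
      Submodule.torsionBy_le_torsionBy_of_dvd _ _ (pow_dvd_pow r hab) hw⟩
  let T := Submodule.torsionBy R Q (r ^ j)
  have hT : Submodule.torsionBy R Q (r ^ j) = Submodule.torsionBy R Q (r ^ (j + 1)) :=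
    hj (j + 1) (Nat.le_succ j)
  have hinj : ∀ w : Q ⧸ T, r • w = 0 → w = 0 := by
    intro w hw
    obtain ⟨w, rfl⟩ := T.mkQ_surjective w
    rw [← map_smul, Submodule.mkQ_apply, Submodule.Quotient.mk_eq_zero,
      Submodule.mem_torsionBy_iff, smul_smul, ← pow_succ, ← Submodule.mem_torsionBy_iff,
      ← hT] at hw
    exact (Submodule.Quotient.mk_eq_zero T).2 hw
  obtain ⟨c, hc⟩ := Ideal.exists_forall_pow_smul_mem_imp (maximalIdeal R) hinj
  obtain ⟨N, hN⟩ := hr (c + 1)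
  have htop : (⊤ : Submodule R (Q ⧸ T)) ≤ maximalIdeal R • ⊤ := by
    rintro w -
    obtain ⟨w, rfl⟩ := T.mkQ_surjective w
    have h1 := Submodule.mem_map_of_mem (f := T.mkQ) (hN (c * N + 1) w)
    rw [Submodule.map_smul'', Submodule.map_top, Submodule.range_mkQ, map_smul] at h1
    have h2 := hc _ _ _ h1
    rwa [show (c + 1) * (c * N + 1) - c * (N + (c * N + 1)) = 1 by
      rw [Nat.sub_eq_iff_eq_add (by nlinarith)]; ring, pow_one] at h2
  have hbot : (⊤ : Submodule R (Q ⧸ T)) = ⊥ :=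
    Submodule.eq_bot_of_le_smul_of_le_jacobson_bot _ _ Module.Finite.fg_top htop
      (maximalIdeal_le_jacobson _)
  refine ⟨j, fun w => ?_⟩
  have : T.mkQ w ∈ (⊥ : Submodule R (Q ⧸ T)) := hbot ▸ trivial
  exact (Submodule.Quotient.mk_eq_zero T).1 this

lemma Ideal.IsPrime.mem_of_smul_mem_smul_top [Module.Finite R Q] {𝔭 : Ideal R} (h𝔭 : 𝔭.IsPrime)
    (hQ : ∀ s : R, (∀ w : Q, s • w = 0) → s = 0) {s : R}
    (hs : ∀ w : Q, s • w ∈ (𝔭 • ⊤ : Submodule R Q)) : s ∈ 𝔭 := by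
  obtain ⟨P, hP, -, hcoeff, heval⟩ :=
    LinearMap.exists_monic_and_natDegree_eq_and_coeff_mem_pow_and_aeval_eq_zero R
      (algebraMap R (Module.End R Q) s) 𝔭 (by rintro _ ⟨w, rfl⟩; exact hs w)
  have h0 : P.eval s = 0 := hQ _ fun w => by
    rw [Polynomial.aeval_algebraMap_apply] at heval
    simpa using LinearMap.congr_fun heval w
  rw [Polynomial.eval_eq_sum_range, Finset.sum_range_succ, hP.coeff_natDegree, one_mul] at h0
  refine h𝔭.mem_of_pow_mem P.natDegree ?_
  rw [← neg_eq_of_add_eq_zero_right h0]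
  refine 𝔭.neg_mem (𝔭.sum_mem fun i hi => Ideal.mul_mem_right _ _ ?_)
  exact Ideal.pow_le_self (Nat.sub_ne_zero_of_lt (Finset.mem_range.1 hi)) (hcoeff i)

lemma LinearMap.apply_mem_smul_top {B : Type*} [CommRing B] [Algebra R B] (f : B →ₗ[R] Q)
    {I : Ideal R} {b : B} (hb : b ∈ I.map (algebraMap R B)) :
    f b ∈ (I • ⊤ : Submodule R Q) := by
  have h : b ∈ (I • ⊤ : Submodule R B) := by rwa [Ideal.smul_top_eq_map]
  have := Submodule.mem_map_of_mem (f := f) h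
  rw [Submodule.map_smul''] at this
  exact Submodule.smul_mono le_rfl le_top this

end LinearGrowth

/-- **Proposition 2.3 (2)**: with `B` Cohen-Macaulay w.r.t. a system of parameters of the
complete noetherian local domain `R`, `π_e` a compatible system of `p`-th power roots
generating an ideal `J`, and `𝔭` a prime of `R` such that some `r ∉ 𝔭` has image in `J`,
the quotient `B/(𝔪B + √(𝔭B))` is not `π^{1/p^∞}`-almost zero. -/
theorem not_almost_zero_mod_radical
    (p : ℕ) (hp : p.Prime)
    (R : Type) [CommRing R] [IsDomain R] [IsNoetherianRing R] [IsLocalRing R]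
    [IsAdicComplete (IsLocalRing.maximalIdeal R) R]
    (B : Type) [CommRing B] [Algebra R B]
    (d : ℕ) (x : Fin d → R) (hx : IsSOP R x)
    (hCM : IsCMwrt (algebraMap R B) x)
    (π : ℕ → B) (hπ : ∀ e : ℕ, π (e + 1) ^ p = π e)
    (𝔭 : Ideal R) (h𝔭 : 𝔭.IsPrime)
    (r : R) (hr : r ∉ 𝔭) (hrJ : algebraMap R B r ∈ Ideal.span (Set.range π)) :
    ¬ Ideal.span (Set.range π) ≤
        Ideal.map (algebraMap R B) (IsLocalRing.maximalIdeal R) ⊔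
          (Ideal.map (algebraMap R B) 𝔭).radical := by
  intro hJ
  obtain ⟨W, _, _, _, Φ, hΦ⟩ := hCM.exists_linearMap_finite hx
  have := isNoetherian_of_isNoetherianRing_of_finite R W
  let M := LinearMap.range Φ
  let P : Submodule R M := 𝔭 • ⊤
  let Ψ : B →ₗ[R] M ⧸ P := P.mkQ ∘ₗ Φ.rangeRestrict
  have hΨ : Function.Surjective Ψ := P.mkQ_surjective.comp Φ.surjective_rangeRestrict
  obtain ⟨j, hj⟩ := IsLocalRing.exists_pow_smul_eq_zero (Q := M ⧸ P) (r := r) fun n => by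
    obtain ⟨c, hc, b, ⟨N, hb⟩, hcb⟩ :=
      Submodule.mem_sup.1 (Ideal.span_range_le_pow_sup hp.one_lt hπ hJ n hrJ)
    refine ⟨N, fun L w => ?_⟩
    have hpow : algebraMap R B r ^ (N + L) ∈
        Ideal.map (algebraMap R B) (IsLocalRing.maximalIdeal R ^ (n * L)) ⊔
          Ideal.map (algebraMap R B) 𝔭 := by
      rw [← hcb]
      refine Ideal.add_pow_mem_of_pow_mem_of_le (m := L) (n := N) _ (Ideal.mem_sup_left ?_)
        (Ideal.mem_sup_right hb) (by omega)
      rw [Ideal.map_pow, pow_mul]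
      exact Ideal.pow_mem_pow hc L
    obtain ⟨b', rfl⟩ := hΨ w
    rw [← map_smul, Algebra.smul_def, map_pow]
    obtain ⟨u, hu, v, hv, huv⟩ := Submodule.mem_sup.1 (Ideal.mul_mem_right b' _ hpow)
    have hΨv : Ψ v = 0 :=
      (Submodule.Quotient.mk_eq_zero P).2 (Φ.rangeRestrict.apply_mem_smul_top hv)
    rw [← huv, map_add, hΨv, add_zero]
    exact Ψ.apply_mem_smul_top hu
  refine hr (h𝔭.mem_of_pow_mem j (h𝔭.mem_of_smul_mem_smul_top (Q := M) (fun s hs => hΦ s ?_)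
    fun w => ?_))
  · rw [Algebra.algebraMap_eq_smul_one, map_smul]
    exact congrArg Subtype.val (hs (Φ.rangeRestrict 1))
  · exact (Submodule.Quotient.mk_eq_zero P).1 (hj (P.mkQ w))
end
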